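/- arXiv:1510.04036 — 3 statements merged into one kernel-verified Lean document; each statement's English description precedes it below -/
import Mathlib

section
/- The generating function G_{k,n}(x,t) = sum_{i,j} beta_{i,j}(I_{k,n}) x^i t^j of the graded Betti numbers of the path ideal of the complete k-ary tree satisfies the recursion G_{k,n}(x,t) = (1 + t * G_{k,n-1}(x,t))^k - 1, with initial condition G_{k,1}(x,t) = (1+tx)^k - 1. -/
open MvPolynomial

/-- Edges of the complete `k`-ary tree of depth `n`. -/
abbrev TreeEdge (k n : ℕ) := Σ i : Fin n, (Fin (i.1 + 1) → Fin k)

/-- Leaves of the complete `k`-ary tree of depth `n`. -/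
abbrev TreeLeaf (k n : ℕ) := Fin n → Fin k

/-- The edge at depth `i+1` on the root-to-leaf path of the leaf `ℓ`. -/
def pathEdge {k n : ℕ} (ℓ : TreeLeaf k n) (i : Fin n) : TreeEdge k n :=
  ⟨i, fun t => ℓ ⟨t.1, lt_of_lt_of_le t.2 i.2⟩⟩

/-- The squarefree monomial of the unique root-to-leaf path of the leaf `ℓ`. -/
noncomputable def pathMonomial (K : Type) [Field K] {k n : ℕ} (ℓ : TreeLeaf k n) :
    MvPolynomial (TreeEdge k n) K :=
  ∏ i : Fin n, X (pathEdge ℓ i)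

/-- The path ideal `I_{k,n}` of the complete `k`-ary tree. -/
noncomputable def pathIdeal (K : Type) [Field K] (k n : ℕ) :
    Ideal (MvPolynomial (TreeEdge k n) K) :=
  Ideal.span (Set.range (pathMonomial K (k := k) (n := n)))

/-- A minimal graded free resolution of `S/I` with graded Betti numbers `b i j`. -/
structure MinGradedFreeRes (K : Type) [Field K] (σ : Type)
    (I : Ideal (MvPolynomial σ K)) (b : ℕ → ℕ → ℕ) : Type where
  d : ∀ i : ℕ,
    ((Σ j : ℕ, Fin (b (i + 1) j)) →₀ MvPolynomial σ K) →ₗ[MvPolynomial σ K]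
    ((Σ j : ℕ, Fin (b i j)) →₀ MvPolynomial σ K)
  aug : ((Σ j : ℕ, Fin (b 0 j)) →₀ MvPolynomial σ K) →ₗ[MvPolynomial σ K]
    (MvPolynomial σ K ⧸ I)
  aug_surjective : Function.Surjective aug
  exact_zero : LinearMap.ker aug = LinearMap.range (d 0)
  exact : ∀ i, LinearMap.ker (d i) = LinearMap.range (d (i + 1))
  graded : ∀ (i : ℕ) (v : Σ j : ℕ, Fin (b (i + 1) j)) (w : Σ j : ℕ, Fin (b i j)),
    (d i (Finsupp.single v 1)) w ≠ 0 →
      w.1 ≤ v.1 ∧ ((d i (Finsupp.single v 1)) w).IsHomogeneous (v.1 - w.1)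
  graded_aug : ∀ v : Σ j : ℕ, Fin (b 0 j), ∃ g : MvPolynomial σ K,
    g.IsHomogeneous v.1 ∧ aug (Finsupp.single v 1) = Ideal.Quotient.mk I g
  minimal : ∀ (i : ℕ) (v : Σ j : ℕ, Fin (b (i + 1) j)) (w : Σ j : ℕ, Fin (b i j)),
    constantCoeff ((d i (Finsupp.single v 1)) w) = 0
  betti_finite : (Function.support fun p : ℕ × ℕ => b p.1 p.2).Finite

/-- The Betti generating function `G(x,t) = ∑_{i,j ≥ 1} β_{i,j}(S/I) x^i t^j`
(equivalently `∑ β_{i,j}(I) x^{i+1} t^j`), a polynomial in `ℤ[x,t]` where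
`x = X 0` and `t = X 1`.  Here `b i j = β_{i,j}(S/I)`. -/
noncomputable def bettiGenFun (b : ℕ → ℕ → ℕ) : MvPolynomial (Fin 2) ℤ :=
  ∑ᶠ p : ℕ × ℕ, (b (p.1 + 1) (p.2 + 1) : ℤ) •
    (X (0 : Fin 2) ^ (p.1 + 1) * X (1 : Fin 2) ^ (p.2 + 1))

/-- Dependent choice along `ℕ` for a family of types. -/
theorem exists_dependent_seq {α : ℕ → Type*} (P : ∀ i, α i → Prop)
    (R : ∀ i, α i → α (i + 1) → Prop) (a₀ : α 0) (h₀ : P 0 a₀)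
    (hs : ∀ i a, P i a → ∃ a', P (i + 1) a' ∧ R i a a') :
    ∃ f : ∀ i, α i, f 0 = a₀ ∧ (∀ i, P i (f i)) ∧ ∀ i, R i (f i) (f (i + 1)) := by
  choose g hg using hs
  let F : ∀ i, {a : α i // P i a} := fun i =>
    Nat.rec ⟨a₀, h₀⟩ (fun i a => ⟨g i a.1 a.2, (hg i a.1 a.2).1⟩) i
  exact ⟨fun i => (F i).1, rfl, fun i => (F i).2, fun i => (hg i (F i).1 (F i).2).2⟩

namespace GradedFree

variable {K : Type} [Field K] {σ : Type} {A B C : Type}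

/-- An element of the graded free module with basis degrees `δ` is homogeneous of degree `n`. -/
def IsHomog (δ : A → ℕ) (n : ℕ) (z : A →₀ MvPolynomial σ K) : Prop :=
  ∀ a, z a ≠ 0 → δ a ≤ n ∧ (z a).IsHomogeneous (n - δ a)

/-- The homogeneous component of degree `n` in `S(-m)`. -/
noncomputable def shiftComp (K : Type) [Field K] (σ : Type) (m n : ℕ) :
    MvPolynomial σ K →ₗ[K] MvPolynomial σ K :=
  if m ≤ n then homogeneousComponent (n - m) else 0

/-- The homogeneous component of degree `n` in a graded free module. -/
noncomputable def comp (δ : A → ℕ) (n : ℕ) :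
    (A →₀ MvPolynomial σ K) →ₗ[K] (A →₀ MvPolynomial σ K) :=
  Finsupp.lsum K fun a => Finsupp.lsingle a ∘ₗ shiftComp K σ (δ a) n

theorem comp_single (δ : A → ℕ) (n : ℕ) (a : A) (f : MvPolynomial σ K) :
    comp δ n (Finsupp.single a f) = Finsupp.single a (shiftComp K σ (δ a) n f) := by
  simp [comp]

theorem comp_apply (δ : A → ℕ) (n : ℕ) (z : A →₀ MvPolynomial σ K) (a : A) :
    comp δ n z a = shiftComp K σ (δ a) n (z a) := by
  classical
  induction z using Finsupp.induction_linear with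
  | zero => simp
  | add f g hf hg => simp [hf, hg]
  | single b f =>
    rw [comp_single, Finsupp.single_apply, Finsupp.single_apply]
    split_ifs with h
    · rw [h]
    · simp

theorem comp_isHomog (δ : A → ℕ) (n : ℕ) (z : A →₀ MvPolynomial σ K) :
    IsHomog δ n (comp δ n z) := by
  intro a ha
  rw [comp_apply, shiftComp] at ha ⊢
  split_ifs at ha ⊢ with h
  · exact ⟨h, homogeneousComponent_isHomogeneous _ _⟩
  · simp at ha

theorem IsHomog.comp_eq {δ : A → ℕ} {n : ℕ} {z : A →₀ MvPolynomial σ K} (hz : IsHomog δ n z) :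
    comp δ n z = z := by
  ext1 a
  rw [comp_apply]
  by_cases h : z a = 0
  · simp [h]
  · rw [shiftComp, if_pos (hz a h).1]
    exact homogeneousComponent_eq_self (hz a h).2

theorem homogeneousComponent_mul_of_isHomogeneous {y : MvPolynomial σ K} {q : ℕ}
    (hy : y.IsHomogeneous q) (p : ℕ) (f : MvPolynomial σ K) :
    homogeneousComponent p (f * y) = if q ≤ p then homogeneousComponent (p - q) f * y else 0 := by
  let := gradedAlgebra (σ := σ) (R := K)
  have h := DirectSum.coe_decompose_mul_of_right_mem (homogeneousSubmodule σ K) (a := f) p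
    ((mem_homogeneousSubmodule q y).2 hy)
  rw [← decomposition.decompose'_apply, ← decomposition.decompose'_apply]
  exact h

theorem shiftComp_mul {m n k : ℕ} {f y : MvPolynomial σ K} (h : k ≤ m)
    (hy : y.IsHomogeneous (m - k)) :
    shiftComp K σ k n (f * y) = shiftComp K σ m n f * y := by
  unfold shiftComp
  by_cases hk : k ≤ n
  · rw [if_pos hk, homogeneousComponent_mul_of_isHomogeneous hy]
    by_cases hm : m ≤ n
    · rw [if_pos hm, if_pos (by omega), show n - k - (m - k) = n - m by omega]
    · rw [if_neg hm, if_neg (by omega)]; simp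
  · rw [if_neg hk, if_neg (by omega)]; simp

theorem comp_smul {δ : A → ℕ} {m : ℕ} (n : ℕ) {y : A →₀ MvPolynomial σ K} (hy : IsHomog δ m y)
    (f : MvPolynomial σ K) : comp δ n (f • y) = shiftComp K σ m n f • y := by
  ext1 a
  rw [comp_apply, Finsupp.smul_apply, Finsupp.smul_apply, smul_eq_mul, smul_eq_mul]
  by_cases h : y a = 0
  · simp [h]
  · exact shiftComp_mul (hy a h).1 (hy a h).2

/-- A linear map of graded free modules that preserves degrees. -/
def IsGraded (δ : A → ℕ) (ε : B → ℕ)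
    (f : (A →₀ MvPolynomial σ K) →ₗ[MvPolynomial σ K] (B →₀ MvPolynomial σ K)) : Prop :=
  ∀ a, IsHomog ε (δ a) (f (Finsupp.single a 1))

theorem single_eq_smul (a : A) (f : MvPolynomial σ K) :
    Finsupp.single a f = f • Finsupp.single a (1 : MvPolynomial σ K) := by simp

theorem IsGraded.comp_map {δ : A → ℕ} {ε : B → ℕ}
    {f : (A →₀ MvPolynomial σ K) →ₗ[MvPolynomial σ K] (B →₀ MvPolynomial σ K)}
    (hf : IsGraded δ ε f) (n : ℕ) (z : A →₀ MvPolynomial σ K) :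
    comp ε n (f z) = f (comp δ n z) := by
  induction z using Finsupp.induction_linear with
  | zero => simp
  | add x y hx hy => simp [hx, hy]
  | single a p =>
    rw [comp_single, single_eq_smul, map_smul, comp_smul n (hf a), ← map_smul, ← single_eq_smul]

theorem IsGraded.isHomog_map {δ : A → ℕ} {ε : B → ℕ}
    {f : (A →₀ MvPolynomial σ K) →ₗ[MvPolynomial σ K] (B →₀ MvPolynomial σ K)}
    (hf : IsGraded δ ε f) {n : ℕ} {z : A →₀ MvPolynomial σ K} (hz : IsHomog δ n z) :
    IsHomog ε n (f z) := by
  rw [← hz.comp_eq, ← hf.comp_map]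
  exact comp_isHomog _ _ _

/-- A graded map whose values lie in the range of a graded map lifts along it. -/
theorem exists_graded_lift {δ : A → ℕ} {ε : B → ℕ} {η : C → ℕ}
    {f : (A →₀ MvPolynomial σ K) →ₗ[MvPolynomial σ K] (C →₀ MvPolynomial σ K)}
    {g : (B →₀ MvPolynomial σ K) →ₗ[MvPolynomial σ K] (C →₀ MvPolynomial σ K)}
    (hf : IsGraded δ η f) (hg : IsGraded ε η g) (h : ∀ x, f x ∈ LinearMap.range g) :
    ∃ φ : (A →₀ MvPolynomial σ K) →ₗ[MvPolynomial σ K] (B →₀ MvPolynomial σ K),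
      IsGraded δ ε φ ∧ ∀ x, g (φ x) = f x := by
  have key : ∀ a, ∃ y, IsHomog ε (δ a) y ∧ g y = f (Finsupp.single a 1) := by
    intro a
    obtain ⟨y, hy⟩ := h (Finsupp.single a 1)
    refine ⟨comp ε (δ a) y, comp_isHomog _ _ _, ?_⟩
    rw [← hg.comp_map, hy, (hf a).comp_eq]
  choose y hy hgy using key
  have hs : ∀ a, Finsupp.linearCombination (MvPolynomial σ K) y (Finsupp.single a 1) = y a := by
    simp
  refine ⟨Finsupp.linearCombination _ y, fun a => ?_, fun x => ?_⟩
  · rw [hs]; exact hy a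
  · induction x using Finsupp.induction_linear with
    | zero => simp
    | add x y hx hy => simp only [map_add, hx, hy]
    | single a p => rw [single_eq_smul, map_smul, map_smul, map_smul, hs, hgy]

/-- A minimal graded free resolution of `S/I`, with bases of arbitrary type and the augmentation
lifted to the polynomial ring. -/
structure Res (I : Ideal (MvPolynomial σ K)) (A : ℕ → Type) (δ : ∀ i, A i → ℕ) where
  d : ∀ i, (A (i + 1) →₀ MvPolynomial σ K) →ₗ[MvPolynomial σ K] (A i →₀ MvPolynomial σ K)
  aug : (A 0 →₀ MvPolynomial σ K) →ₗ[MvPolynomial σ K] MvPolynomial σ K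
  surj : ∀ s, ∃ x, aug x - s ∈ I
  exact_zero : ∀ x, aug x ∈ I ↔ x ∈ LinearMap.range (d 0)
  exact : ∀ i, LinearMap.ker (d i) = LinearMap.range (d (i + 1))
  graded : ∀ i, IsGraded (δ (i + 1)) (δ i) (d i)
  graded_aug : ∀ v, (aug (Finsupp.single v 1)).IsHomogeneous (δ 0 v)
  minimal : ∀ i v w, constantCoeff (d i (Finsupp.single v 1) w) = 0

variable {I : Ideal (MvPolynomial σ K)} {A B : ℕ → Type} {δ : ∀ i, A i → ℕ} {ε : ∀ i, B i → ℕ}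

theorem Res.d_d (F : Res I A δ) (i : ℕ) (x) : F.d i (F.d (i + 1) x) = 0 := by
  rw [← LinearMap.mem_ker, F.exact]
  exact ⟨x, rfl⟩

theorem Res.homogeneousComponent_aug (F : Res I A δ) (n : ℕ) (z) :
    homogeneousComponent n (F.aug z) = F.aug (comp (δ 0) n z) := by
  induction z using Finsupp.induction_linear with
  | zero => simp
  | add x y hx hy => simp only [map_add, hx, hy]
  | single a p =>
    rw [comp_single, single_eq_smul, map_smul F.aug, single_eq_smul a (shiftComp _ _ _ _ _),
      map_smul F.aug, smul_eq_mul, smul_eq_mul]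
    have := shiftComp_mul (f := p) (n := n) (Nat.zero_le _) (F.graded_aug a)
    simpa [shiftComp] using this

theorem Res.exists_chainMap (hI : ∀ n, ∀ f ∈ I, homogeneousComponent n f ∈ I)
    (F : Res I A δ) (T : Res I B ε) :
    ∃ φ : ∀ i, (A i →₀ MvPolynomial σ K) →ₗ[MvPolynomial σ K] (B i →₀ MvPolynomial σ K),
      (∀ i, IsGraded (δ i) (ε i) (φ i)) ∧ (∀ x, T.aug (φ 0 x) - F.aug x ∈ I) ∧
      ∀ i x, T.d i (φ (i + 1) x) = φ i (F.d i x) := by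
  have h0 : ∃ φ : (A 0 →₀ MvPolynomial σ K) →ₗ[MvPolynomial σ K] (B 0 →₀ MvPolynomial σ K),
      IsGraded (δ 0) (ε 0) φ ∧ ∀ x, T.aug (φ x) - F.aug x ∈ I := by
    have key : ∀ a, ∃ y, IsHomog (ε 0) (δ 0 a) y ∧
        T.aug y - F.aug (Finsupp.single a 1) ∈ I := by
      intro a
      obtain ⟨y, hy⟩ := T.surj (F.aug (Finsupp.single a 1))
      refine ⟨comp (ε 0) (δ 0 a) y, comp_isHomog _ _ _, ?_⟩
      have := hI (δ 0 a) _ hy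
      rwa [map_sub, T.homogeneousComponent_aug,
        homogeneousComponent_eq_self (F.graded_aug a)] at this
    choose y hy hgy using key
    have hs : ∀ a, Finsupp.linearCombination (MvPolynomial σ K) y (Finsupp.single a 1) = y a := by
      simp
    refine ⟨Finsupp.linearCombination _ y, fun a => ?_, fun x => ?_⟩
    · rw [hs]; exact hy a
    · induction x using Finsupp.induction_linear with
      | zero => simp
      | add x y hx hy =>
        simp only [map_add]
        rw [add_sub_add_comm]
        exact I.add_mem hx hy
      | single a p =>
        rw [single_eq_smul, map_smul, map_smul, map_smul, hs, ← smul_sub]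
        exact I.mul_mem_left _ (hgy a)
  obtain ⟨φ0, hφ0, hφ0'⟩ := h0
  have hP0 : ∀ x, φ0 (F.d 0 x) ∈ LinearMap.range (T.d 0) := fun x => by
    rw [← T.exact_zero]
    simpa using I.add_mem (hφ0' (F.d 0 x)) ((F.exact_zero (F.d 0 x)).2 ⟨x, rfl⟩)
  obtain ⟨f, hf0, hfP, hf⟩ := exists_dependent_seq
    (α := fun i => (A i →₀ MvPolynomial σ K) →ₗ[MvPolynomial σ K] (B i →₀ MvPolynomial σ K))
    (P := fun i φ => IsGraded (δ i) (ε i) φ ∧ ∀ x, φ (F.d i x) ∈ LinearMap.range (T.d i))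
    (R := fun i φ ψ => ∀ x, T.d i (ψ x) = φ (F.d i x)) φ0 ⟨hφ0, hP0⟩
    (fun i φ ⟨hφ, hr⟩ => by
      obtain ⟨ψ, hψ, hψd⟩ := exists_graded_lift (f := φ ∘ₗ F.d i) (g := T.d i)
        (fun a => hφ.isHomog_map (F.graded i a)) (T.graded i) hr
      refine ⟨ψ, ⟨hψ, fun x => ?_⟩, hψd⟩
      rw [← T.exact, LinearMap.mem_ker, hψd, LinearMap.comp_apply, F.d_d, map_zero])
  exact ⟨f, fun i => (hfP i).1, by rwa [hf0], hf⟩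

theorem constantCoeff_map_eq_zero {A B : Type} {z : A →₀ MvPolynomial σ K}
    (hz : ∀ a, constantCoeff (z a) = 0)
    (f : (A →₀ MvPolynomial σ K) →ₗ[MvPolynomial σ K] (B →₀ MvPolynomial σ K)) (b : B) :
    constantCoeff (f z b) = 0 := by
  have h : f z = z.sum fun a c => c • f (Finsupp.single a 1) := by
    conv_lhs => rw [← Finsupp.sum_single z]
    rw [map_finsuppSum]
    refine Finsupp.sum_congr fun a _ => ?_
    rw [single_eq_smul, map_smul]
  rw [h, Finsupp.sum, Finsupp.finsetSum_apply, map_sum]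
  refine Finset.sum_eq_zero fun a _ => ?_
  rw [Finsupp.smul_apply, smul_eq_mul, map_mul, hz, zero_mul]

theorem Res.constantCoeff_d (F : Res I A δ) (i : ℕ) (z) (w : A i) :
    constantCoeff (F.d i z w) = 0 := by
  induction z using Finsupp.induction_linear with
  | zero => simp
  | add x y hx hy => simp [hx, hy]
  | single a p =>
    rw [single_eq_smul, map_smul, Finsupp.smul_apply, smul_eq_mul, map_mul, F.minimal, mul_zero]

theorem exists_lift {A B C : Type}
    {f : (A →₀ MvPolynomial σ K) →ₗ[MvPolynomial σ K] (C →₀ MvPolynomial σ K)}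
    {g : (B →₀ MvPolynomial σ K) →ₗ[MvPolynomial σ K] (C →₀ MvPolynomial σ K)}
    (h : ∀ x, f x ∈ LinearMap.range g) :
    ∃ φ : (A →₀ MvPolynomial σ K) →ₗ[MvPolynomial σ K] (B →₀ MvPolynomial σ K),
      ∀ x, g (φ x) = f x := by
  obtain ⟨φ, hφ⟩ := Module.projective_lifting_property g.rangeRestrict
    (f.codRestrict (LinearMap.range g) h) g.surjective_rangeRestrict
  exact ⟨φ, fun x => congrArg Subtype.val (LinearMap.congr_fun hφ x)⟩

/-- A chain endomorphism of a minimal resolution lifting zero vanishes modulo the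
homogeneous maximal ideal. -/
theorem Res.constantCoeff_chainMap (F : Res I A δ)
    (u : ∀ i, (A i →₀ MvPolynomial σ K) →ₗ[MvPolynomial σ K] (A i →₀ MvPolynomial σ K))
    (hu0 : ∀ x, F.aug (u 0 x) ∈ I) (hu : ∀ i x, F.d i (u (i + 1) x) = u i (F.d i x))
    (i : ℕ) (x) (w : A i) : constantCoeff (u i x w) = 0 := by
  obtain ⟨h0, hh0⟩ := exists_lift (f := u 0) (g := F.d 0) fun x => (F.exact_zero _).1 (hu0 x)
  obtain ⟨h, h_zero, -, h_succ⟩ := exists_dependent_seq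
    (α := fun i =>
      (A i →₀ MvPolynomial σ K) →ₗ[MvPolynomial σ K] (A (i + 1) →₀ MvPolynomial σ K))
    (P := fun i h => ∀ x, F.d i (h (F.d i x)) = u i (F.d i x))
    (R := fun i h h' => ∀ x, F.d (i + 1) (h' x) = u (i + 1) x - h (F.d i x)) h0
    (fun x => hh0 _) (fun i h hP => by
      obtain ⟨h', hh'⟩ := exists_lift (f := u (i + 1) - h ∘ₗ F.d i) (g := F.d (i + 1)) fun x => by
        rw [← F.exact, LinearMap.mem_ker, LinearMap.sub_apply, LinearMap.comp_apply, map_sub,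
          hP, hu, sub_self]
      exact ⟨h', fun x => by rw [hh', LinearMap.sub_apply, LinearMap.comp_apply, F.d_d, map_zero,
        sub_zero], hh'⟩)
  cases i with
  | zero =>
    rw [← hh0]
    exact F.constantCoeff_d _ _ _
  | succ i =>
    rw [show u (i + 1) x = F.d (i + 1) (h (i + 1) x) + h i (F.d i x) by rw [h_succ]; abel,
      Finsupp.add_apply, map_add, F.constantCoeff_d,
      constantCoeff_map_eq_zero (F.constantCoeff_d _ _), add_zero]

theorem IsGraded.constantCoeff_eq_zero {A B : Type} {δ : A → ℕ} {ε : B → ℕ}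
    {f : (A →₀ MvPolynomial σ K) →ₗ[MvPolynomial σ K] (B →₀ MvPolynomial σ K)}
    (hf : IsGraded δ ε f) {a : A} {b : B} (h : δ a ≠ ε b) :
    constantCoeff (f (Finsupp.single a 1) b) = 0 := by
  by_cases h0 : f (Finsupp.single a 1) b = 0
  · simp [h0]
  · obtain ⟨hle, hhom⟩ := hf a b h0
    by_contra hc
    have := hhom (d := 0) (by simpa [constantCoeff_eq] using hc)
    simp at this
    omega

/-- The degree-`j` block of a linear map of graded free modules modulo the homogeneous
maximal ideal. -/
noncomputable def block {A B : Type} (δ : A → ℕ) (ε : B → ℕ) (j : ℕ)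
    (f : (A →₀ MvPolynomial σ K) →ₗ[MvPolynomial σ K] (B →₀ MvPolynomial σ K)) :
    Matrix {a // δ a = j} {b // ε b = j} K :=
  Matrix.of fun a b => constantCoeff (f (Finsupp.single a.1 1) b.1)

theorem block_mul_block {A B : Type} [Fintype A] [Fintype B] [DecidableEq A] {δ : A → ℕ}
    {ε : B → ℕ} (j : ℕ)
    {f : (A →₀ MvPolynomial σ K) →ₗ[MvPolynomial σ K] (B →₀ MvPolynomial σ K)}
    {g : (B →₀ MvPolynomial σ K) →ₗ[MvPolynomial σ K] (A →₀ MvPolynomial σ K)}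
    (hf : IsGraded δ ε f)
    (h : ∀ x a, constantCoeff (g (f x) a - x a) = 0) :
    block δ ε j f * block ε δ j g = 1 := by
  ext a a'
  rw [Matrix.mul_apply]
  have h1 := h (Finsupp.single a.1 1) a'.1
  have h2 : g (f (Finsupp.single a.1 1)) =
      ∑ b, f (Finsupp.single a.1 1) b • g (Finsupp.single b 1) := by
    conv_lhs => rw [← Finsupp.sum_single (f (Finsupp.single a.1 1))]
    rw [map_finsuppSum, Finsupp.sum_fintype _ _ (by simp)]
    refine Finset.sum_congr rfl fun b _ => ?_
    rw [single_eq_smul, map_smul]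
  rw [h2, map_sub, sub_eq_zero, Finsupp.finsetSum_apply, map_sum] at h1
  have h3 : (constantCoeff ((Finsupp.single a.1 (1 : MvPolynomial σ K)) a'.1) : K) =
      (1 : Matrix {a // δ a = j} {a // δ a = j} K) a a' := by
    rw [Matrix.one_apply, Finsupp.single_apply]
    simp only [Subtype.ext_iff]
    split_ifs <;> simp
  rw [← h3, ← h1]
  simp only [block, Matrix.of_apply, Finsupp.smul_apply, smul_eq_mul, map_mul]
  rw [← Finset.sum_subtype (Finset.univ.filter fun b => ε b = j) (by simp)
    fun b => constantCoeff (f (Finsupp.single a.1 1) b) *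
      constantCoeff (g (Finsupp.single b 1) a'.1), Finset.sum_filter]
  refine Finset.sum_congr rfl fun b _ => ?_
  split_ifs with hb
  · rfl
  · rw [hf.constantCoeff_eq_zero (a := a.1) (b := b) (by rw [a.2]; exact Ne.symm hb), zero_mul]

/-- Graded Betti numbers do not depend on the minimal graded free resolution. -/
theorem Res.card_eq (hI : ∀ n, ∀ f ∈ I, homogeneousComponent n f ∈ I)
    (F : Res I A δ) (T : Res I B ε) (i j : ℕ) [Fintype (A i)] [Fintype (B i)] :
    Fintype.card {a : A i // δ i a = j} = Fintype.card {b : B i // ε i b = j} := by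
  classical
  obtain ⟨φ, hφ, hφ0, hφd⟩ := F.exists_chainMap hI T
  obtain ⟨ψ, hψ, hψ0, hψd⟩ := T.exists_chainMap hI F
  refine Matrix.square_of_invertible (block (δ i) (ε i) j (φ i)) (block (ε i) (δ i) j (ψ i))
    (block_mul_block j (hφ i) fun x w => ?_) (block_mul_block j (hψ i) fun x w => ?_)
  · refine F.constantCoeff_chainMap (fun i => ψ i ∘ₗ φ i - LinearMap.id) (fun x => ?_)
      (fun i x => ?_) i x w
    · have := I.add_mem (hψ0 (φ 0 x)) (hφ0 x)
      rw [sub_add_sub_cancel] at this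
      simpa using this
    · simp [hψd, hφd]
  · refine T.constantCoeff_chainMap (fun i => φ i ∘ₗ ψ i - LinearMap.id) (fun x => ?_)
      (fun i x => ?_) i x w
    · have := I.add_mem (hφ0 (ψ 0 x)) (hψ0 x)
      rw [sub_add_sub_cancel] at this
      simpa using this
    · simp [hψd, hφd]

end GradedFree

namespace Taylor

open Finset

section Simplex

variable {ι : Type} [LinearOrder ι] {R : Type} [CommRing R]

/-- The sign of `ℓ` in `insert ℓ L`. -/
def sgn (R : Type) [CommRing R] (ℓ : ι) (L : Finset ι) : R := (-1) ^ #{x ∈ L | x < ℓ}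

theorem sgn_mul_self (ℓ : ι) (L : Finset ι) : sgn R ℓ L * sgn R ℓ L = 1 := by
  rw [sgn, ← pow_add, ← two_mul, pow_mul]; simp

theorem sgn_insert_of_lt {p q : ι} {L : Finset ι} (hp : p ∉ L) (h : p < q) :
    sgn R q (insert p L) = - sgn R q L := by
  rw [sgn, filter_insert, if_pos h, card_insert_of_notMem (by simp [hp]), pow_succ, sgn]
  ring

theorem sgn_insert_of_not_lt {p q : ι} {L : Finset ι} (h : ¬ p < q) :
    sgn R q (insert p L) = sgn R q L := by
  rw [sgn, filter_insert, if_neg h, sgn]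

theorem sgn_mul_sgn_insert {p q : ι} {L : Finset ι} (hp : p ∉ L) (hq : q ∉ L) (hpq : p ≠ q) :
    sgn R p L * sgn R q (insert p L) = - (sgn R q L * sgn R p (insert q L)) := by
  rcases lt_or_gt_of_ne hpq with h | h
  · rw [sgn_insert_of_lt hp h, sgn_insert_of_not_lt h.not_gt]; ring
  · rw [sgn_insert_of_lt hq h, sgn_insert_of_not_lt h.not_gt]; ring

theorem sgn_insert_mul_sgn_insert {p q : ι} {L : Finset ι} (hp : p ∉ L) (hq : q ∉ L)
    (hpq : p ≠ q) :
    sgn R p (insert q L) * sgn R q (insert p L) = - (sgn R p L * sgn R q L) := by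
  rcases lt_or_gt_of_ne hpq with h | h
  · rw [sgn_insert_of_lt hp h, sgn_insert_of_not_lt h.not_gt]; ring
  · rw [sgn_insert_of_lt hq h, sgn_insert_of_not_lt h.not_gt]; ring

variable [Fintype ι]

/-- The differential of the augmented chain complex of the full simplex. -/
def bd (c : Finset ι → R) (L : Finset ι) : R := ∑ ℓ ∈ Lᶜ, sgn R ℓ L * c (insert ℓ L)

theorem bd_bd (c : Finset ι → R) (L : Finset ι) : bd (bd c) L = 0 := by
  simp only [bd, mul_sum]
  rw [sum_sigma']
  refine sum_involution (fun x _ => ⟨x.2, x.1⟩) ?_ ?_ ?_ ?_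
  · rintro ⟨p, q⟩ h
    simp only [mem_sigma, mem_compl, mem_insert, not_or] at h
    dsimp only
    rw [insert_comm q p, ← mul_assoc, ← mul_assoc, sgn_mul_sgn_insert h.1 h.2.2 (Ne.symm h.2.1)]
    ring
  · rintro ⟨p, q⟩ h _ he
    simp only [mem_sigma, mem_compl, mem_insert, not_or] at h
    simp only [Sigma.mk.injEq, heq_eq_eq] at he
    exact h.2.1 he.1
  · rintro ⟨p, q⟩ h
    simp only [mem_sigma, mem_compl, mem_insert, not_or] at h ⊢
    exact ⟨h.2.2, Ne.symm h.2.1, h.1⟩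
  · intros; rfl

/-- The cone with apex `p`, a contracting homotopy of the simplex. -/
def cone (p : ι) (c : Finset ι → R) (L : Finset ι) : R :=
  if p ∈ L then sgn R p (L.erase p) * c (L.erase p) else 0

theorem bd_cone_add (p : ι) (c : Finset ι → R) (L : Finset ι) :
    bd (cone p c) L + cone p (bd c) L = c L := by
  by_cases hp : p ∈ L
  · obtain ⟨M, hM, rfl⟩ : ∃ M, p ∉ M ∧ L = insert p M :=
      ⟨L.erase p, by simp, (insert_erase hp).symm⟩
    have h1 : (insert p M)ᶜ = Mᶜ.erase p := by rw [compl_insert]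
    have hpM : p ∈ Mᶜ := by simpa
    rw [cone, if_pos hp, erase_insert hM, bd, bd, h1, ← add_sum_erase _ _ hpM, mul_add,
      ← mul_assoc, sgn_mul_self, one_mul, mul_sum, add_left_comm, ← sum_add_distrib]
    rw [sum_eq_zero, add_zero]
    intro q hq
    simp only [mem_erase, mem_compl] at hq
    rw [cone, if_pos (by simp), insert_comm, erase_insert (by simp [hM, Ne.symm hq.1]),
      ← mul_assoc, ← mul_assoc, sgn_insert_mul_sgn_insert hq.2 hM hq.1]
    ring
  · rw [cone, if_neg hp, add_zero, bd, sum_eq_single p]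
    · rw [cone, if_pos (by simp), erase_insert hp, ← mul_assoc, sgn_mul_self, one_mul]
    · intro q _ hqp
      rw [cone, if_neg (by simp [hp, Ne.symm hqp]), mul_zero]
    · simp [hp]

theorem bd_cone {c : Finset ι → R} (hc : ∀ L, bd c L = 0) (p : ι) (L : Finset ι) :
    bd (cone p c) L = c L := by
  rw [← bd_cone_add p c L, left_eq_add]
  simp [cone, hc]

end Simplex

section Complex

variable {ι : Type} {K : Type} [Field K] {σ : Type}
  (m : ι → σ →₀ ℕ)

open Classical in
/-- The strand of multidegree `a`, as a simplicial chain. -/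
noncomputable def strand (a : σ →₀ ℕ) (x : Finset ι → MvPolynomial σ K) (L : Finset ι) : K :=
  if L.sup m ≤ a then coeff (a - L.sup m) (x L) else 0

open Classical in
/-- The element of multidegree `a` with a given simplicial chain as strand. -/
noncomputable def place (a : σ →₀ ℕ) (c : Finset ι → K) (L : Finset ι) : MvPolynomial σ K :=
  if L.sup m ≤ a then monomial (a - L.sup m) (c L) else 0

theorem ext_strand {x y : Finset ι → MvPolynomial σ K}
    (h : ∀ a L, strand m a x L = strand m a y L) : x = y := by
  funext L
  ext u
  simpa [strand] using h (u + L.sup m) L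

theorem strand_sum {κ : Type*} (s : Finset κ) (f : κ → Finset ι → MvPolynomial σ K)
    (a : σ →₀ ℕ) (L : Finset ι) :
    strand m a (∑ i ∈ s, f i) L = ∑ i ∈ s, strand m a (f i) L := by
  simp only [strand, Finset.sum_apply, coeff_sum]
  split_ifs <;> simp

theorem sup_le_of_strand_ne_zero {a : σ →₀ ℕ} {x : Finset ι → MvPolynomial σ K} {L : Finset ι}
    (h : strand m a x L ≠ 0) : L.sup m ≤ a := by
  by_contra h'
  exact h (if_neg h')

theorem ne_zero_of_strand_ne_zero {a : σ →₀ ℕ} {x : Finset ι → MvPolynomial σ K} {L : Finset ι}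
    (h : strand m a x L ≠ 0) : x L ≠ 0 := by
  intro h'
  simp [strand, h'] at h

variable [LinearOrder ι]

theorem sup_le_sup_insert (ℓ : ι) (L : Finset ι) : L.sup m ≤ (insert ℓ L).sup m :=
  sup_mono (subset_insert _ _)

variable [Fintype ι]

/-- The Taylor differential on functions from subsets of generators to the polynomial ring. -/
noncomputable def diff :
    (Finset ι → MvPolynomial σ K) →ₗ[MvPolynomial σ K] (Finset ι → MvPolynomial σ K) :=
  LinearMap.pi fun L => ∑ ℓ ∈ Lᶜ,
    monomial ((insert ℓ L).sup m - L.sup m) (sgn K ℓ L) • LinearMap.proj (insert ℓ L)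

theorem diff_apply (x : Finset ι → MvPolynomial σ K) (L : Finset ι) :
    diff m x L = ∑ ℓ ∈ Lᶜ,
      monomial ((insert ℓ L).sup m - L.sup m) (sgn K ℓ L) * x (insert ℓ L) := by
  simp [diff]

theorem strand_diff (a : σ →₀ ℕ) (x : Finset ι → MvPolynomial σ K) (L : Finset ι) :
    strand m a (diff m x) L = bd (strand m a x) L := by
  rw [strand, bd]
  split_ifs with h
  · rw [diff_apply, coeff_sum]
    refine sum_congr rfl fun ℓ _ => ?_
    have hle := sup_le_sup_insert m ℓ L
    have hiff : (insert ℓ L).sup m - L.sup m ≤ a - L.sup m ↔ (insert ℓ L).sup m ≤ a := by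
      constructor
      · intro h' s
        have h1 := h' s
        have h2 := hle s
        have h3 := h s
        simp only [Finsupp.tsub_apply] at h1
        omega
      · exact fun h' => tsub_le_tsub_right h' _
    rw [coeff_monomial_mul', strand]
    simp only [hiff]
    split_ifs with h'
    · congr 2
      ext s
      have h2 := hle s
      simp only [Finsupp.tsub_apply]
      omega
    · simp
  · symm
    refine sum_eq_zero fun ℓ _ => ?_
    rw [strand, if_neg fun h' => h ((sup_le_sup_insert m ℓ L).trans h'), mul_zero]

theorem diff_diff (x : Finset ι → MvPolynomial σ K) : diff m (diff m x) = 0 := by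
  refine ext_strand m fun a L => ?_
  rw [strand_diff, show strand m a (diff m x) = bd (strand m a x) from
    funext (strand_diff m a x), bd_bd]
  simp [strand]

open Classical in
theorem strand_place {a : σ →₀ ℕ} {c : Finset ι → K} (hc : ∀ L, c L ≠ 0 → L.sup m ≤ a)
    (a' : σ →₀ ℕ) (L : Finset ι) :
    strand m a' (place m a c) L = if a = a' then c L else 0 := by
  by_cases hL : L.sup m ≤ a
  · rw [strand, place, if_pos hL, coeff_monomial]
    by_cases ha : a = a'
    · subst ha; simp [hL]
    · rw [if_neg ha]
      split_ifs with h1 h2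
      · exact absurd (by rw [← tsub_add_cancel_of_le hL, h2, tsub_add_cancel_of_le h1]) ha
      · rfl
      · rfl
  · rw [strand, place, if_neg hL, not_imp_comm.1 (hc L) hL]
    simp

theorem diff_place {a : σ →₀ ℕ} {c : Finset ι → K} (hc : ∀ L, c L ≠ 0 → L.sup m ≤ a) :
    diff m (place m a c) = place m a (bd c) := by
  refine ext_strand m fun a' L => ?_
  rw [strand_diff, strand_place, bd]
  · simp only [strand_place m hc]
    split_ifs
    · rfl
    · simp
  · intro L hL
    obtain ⟨ℓ, -, hℓ⟩ := exists_ne_zero_of_sum_ne_zero hL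
    exact (sup_le_sup_insert m ℓ L).trans (hc _ (right_ne_zero_of_mul hℓ))

/-- Exactness of the Taylor complex. -/
theorem exists_diff_eq {x : Finset ι → MvPolynomial σ K} (hx : diff m x = 0)
    (hp : ∀ a L, strand m a x L ≠ 0 → ∃ p, m p ≤ a) :
    ∃ y, diff m y = x ∧ ∀ i, (∀ L, #L ≠ i → x L = 0) → ∀ L, #L ≠ i + 1 → y L = 0 := by
  classical
  have hbd : ∀ a L, bd (strand m a x) L = 0 := fun a L => by
    rw [← strand_diff, hx]; simp [strand]
  have key : ∀ a, ∃ y, diff m y = place m a (strand m a x) ∧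
      ∀ i, (∀ L, #L ≠ i → x L = 0) → ∀ L, #L ≠ i + 1 → y L = 0 := by
    intro a
    by_cases h : ∃ p, m p ≤ a
    · obtain ⟨p, hpa⟩ := h
      refine ⟨place m a (cone p (strand m a x)), ?_, fun i hi L hL => ?_⟩
      · rw [diff_place]
        · congr 1
          funext L
          exact bd_cone (hbd a) p L
        · intro L hL
          unfold cone at hL
          split_ifs at hL with hpL
          · rw [← insert_erase hpL, sup_insert]
            exact sup_le hpa (sup_le_of_strand_ne_zero m (right_ne_zero_of_mul hL))
          · exact absurd rfl hL
      · unfold place cone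
        split_ifs with h1 h2
        · rw [not_imp_comm.1 (ne_zero_of_strand_ne_zero m (a := a) (x := x) (L := L.erase p)),
            mul_zero, map_zero]
          rw [not_not]
          refine hi _ fun h => hL ?_
          rw [← card_erase_add_one h2, h]
        · simp
        · rfl
    · refine ⟨0, ?_, fun _ _ _ _ => rfl⟩
      funext L
      have : strand m a x L = 0 := by
        by_contra h'
        exact h (hp a L h')
      simp [place, this]
  choose y hy hyi using key
  let s : Finset (σ →₀ ℕ) := univ.biUnion fun L => (x L).support.image (· + L.sup m)
  refine ⟨∑ a ∈ s, y a, ?_, fun i hi L hL => ?_⟩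
  · rw [map_sum]
    refine ext_strand m fun a L => ?_
    rw [strand_sum]
    simp only [hy, strand_place m (fun L => sup_le_of_strand_ne_zero m)]
    rw [sum_ite_eq' s a fun a => strand m a x L]
    split_ifs with ha
    · rfl
    · by_contra h
      refine ha ?_
      have hle := sup_le_of_strand_ne_zero m (Ne.symm h)
      rw [mem_biUnion]
      refine ⟨L, mem_univ _, mem_image.2 ⟨a - L.sup m, ?_, tsub_add_cancel_of_le hle⟩⟩
      rw [mem_support_iff]
      rw [strand, if_pos hle] at h
      exact Ne.symm h
  · rw [Finset.sum_apply]
    exact sum_eq_zero fun a _ => hyi a i hi L hL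

end Complex

end Taylor

namespace Taylor

open Finset GradedFree

variable {ι : Type} {K : Type} [Field K] {σ : Type}

/-- Extension by zero from subsets of cardinality `i` to all subsets. -/
noncomputable def extend (i : ℕ) :
    ({L : Finset ι // #L = i} →₀ MvPolynomial σ K) →ₗ[MvPolynomial σ K]
      (Finset ι → MvPolynomial σ K) :=
  LinearMap.pi fun L => if h : #L = i then Finsupp.lapply ⟨L, h⟩ else 0

theorem extend_of_card (i : ℕ) (x : {L : Finset ι // #L = i} →₀ MvPolynomial σ K) (L) :
    extend i x L.1 = x L := by
  simp [extend, L.2]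

theorem extend_of_card_ne {i : ℕ} (x : {L : Finset ι // #L = i} →₀ MvPolynomial σ K)
    {L : Finset ι} (h : #L ≠ i) : extend i x L = 0 := by
  simp [extend, h]

open Classical in
theorem extend_single (i : ℕ) (v : {L : Finset ι // #L = i}) (L : Finset ι) :
    extend i (Finsupp.single v (1 : MvPolynomial σ K)) L = if L = v.1 then 1 else 0 := by
  by_cases hL : #L = i
  · rw [show L = (⟨L, hL⟩ : {L : Finset ι // #L = i}).1 from rfl, extend_of_card,
      Finsupp.single_apply]
    simp only [Subtype.ext_iff, eq_comm]
  · rw [extend_of_card_ne _ hL, if_neg]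
    rintro rfl
    exact hL v.2

variable [Fintype ι]

/-- Restriction to subsets of cardinality `i`. -/
noncomputable def restrict (i : ℕ) :
    (Finset ι → MvPolynomial σ K) →ₗ[MvPolynomial σ K]
      ({L : Finset ι // #L = i} →₀ MvPolynomial σ K) :=
  (Finsupp.linearEquivFunOnFinite _ _ _).symm.toLinearMap ∘ₗ
    LinearMap.funLeft _ _ Subtype.val

theorem restrict_apply (i : ℕ) (X : Finset ι → MvPolynomial σ K) (L) :
    restrict i X L = X L.1 := rfl

theorem restrict_extend (i : ℕ) (x : {L : Finset ι // #L = i} →₀ MvPolynomial σ K) :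
    restrict i (extend i x) = x := by
  ext1 L
  rw [restrict_apply, extend_of_card]

theorem extend_restrict {i : ℕ} {X : Finset ι → MvPolynomial σ K}
    (h : ∀ L, #L ≠ i → X L = 0) : extend i (restrict i X) = X := by
  funext L
  by_cases hL : #L = i
  · exact extend_of_card i _ ⟨L, hL⟩
  · rw [extend_of_card_ne _ hL, h L hL]

variable [LinearOrder ι] (m : ι → σ →₀ ℕ)

theorem diff_eq_zero_of_card {i : ℕ} {X : Finset ι → MvPolynomial σ K}
    (h : ∀ L, #L ≠ i + 1 → X L = 0) (L : Finset ι) (hL : #L ≠ i) : diff m X L = 0 := by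
  rw [diff_apply]
  refine sum_eq_zero fun ℓ hℓ => ?_
  rw [h, mul_zero]
  rw [card_insert_of_notMem (by simpa using hℓ)]
  omega

/-- The ideal generated by the monomials with exponents `m ℓ`. -/
noncomputable def monomialIdeal (K : Type) [Field K] {ι σ : Type} (m : ι → σ →₀ ℕ) :
    Ideal (MvPolynomial σ K) :=
  Ideal.span (Set.range fun ℓ => monomial (m ℓ) (1 : K))

theorem mem_monomialIdeal {ι σ : Type} (m : ι → σ →₀ ℕ) (f : MvPolynomial σ K) :
    f ∈ monomialIdeal K m ↔ ∀ u, coeff u f ≠ 0 → ∃ ℓ, m ℓ ≤ u := by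
  have h := mem_ideal_span_monomial_image (x := f) (s := Set.range m)
  rw [← Set.range_comp] at h
  simpa [monomialIdeal, mem_support_iff, Function.comp_def] using h

theorem homogeneousComponent_mem_monomialIdeal {ι σ : Type} (m : ι → σ →₀ ℕ) (n : ℕ)
    (f : MvPolynomial σ K) (hf : f ∈ monomialIdeal K m) :
    homogeneousComponent n f ∈ monomialIdeal K m := by
  rw [mem_monomialIdeal] at hf ⊢
  intro u hu
  refine hf u fun h => hu ?_
  rw [coeff_homogeneousComponent, h, ite_self]

/-- The differential of the Taylor resolution in homological degree `i + 1`. -/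
noncomputable def resDiff (K : Type) [Field K] (i : ℕ) :
    ({L : Finset ι // #L = i + 1} →₀ MvPolynomial σ K) →ₗ[MvPolynomial σ K]
      ({L : Finset ι // #L = i} →₀ MvPolynomial σ K) :=
  restrict i ∘ₗ diff m ∘ₗ extend (i + 1)

theorem extend_resDiff (i : ℕ) (x) : extend i (resDiff m K i x) = diff m (extend (i + 1) x) :=
  extend_restrict (diff_eq_zero_of_card m fun _ h => extend_of_card_ne x h)

theorem mem_range_resDiff {i : ℕ} {x : {L : Finset ι // #L = i} →₀ MvPolynomial σ K}
    (hx : diff m (extend i x) = 0)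
    (hp : ∀ a L, strand m a (extend i x) L ≠ 0 → ∃ p, m p ≤ a) :
    x ∈ LinearMap.range (resDiff m K i) := by
  obtain ⟨y, hy, hyi⟩ := exists_diff_eq m hx hp
  refine ⟨restrict (i + 1) y, ?_⟩
  rw [resDiff, LinearMap.comp_apply, LinearMap.comp_apply,
    extend_restrict (hyi i fun _ h => extend_of_card_ne x h), hy, restrict_extend]

theorem aug_mem_iff (x : {L : Finset ι // #L = 0} →₀ MvPolynomial σ K) :
    x ⟨∅, rfl⟩ ∈ monomialIdeal K m ↔ x ∈ LinearMap.range (resDiff m K 0) := by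
  constructor
  · intro h
    refine mem_range_resDiff m ?_ fun a L hL => ?_
    · funext L
      rw [diff_apply]
      exact sum_eq_zero fun ℓ _ => by rw [extend_of_card_ne x (by simp), mul_zero]
    · have h0 : #L = 0 := by
        by_contra h0
        exact ne_zero_of_strand_ne_zero m hL (extend_of_card_ne x h0)
      obtain rfl := card_eq_zero.1 h0
      simp only [strand, sup_empty, bot_le, if_true] at hL
      rw [extend_of_card 0 x ⟨∅, rfl⟩] at hL
      obtain ⟨ℓ, hℓ⟩ := (mem_monomialIdeal m _).1 h _ hL
      exact ⟨ℓ, hℓ.trans tsub_le_self⟩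
  · rintro ⟨y, rfl⟩
    rw [resDiff, LinearMap.comp_apply, LinearMap.comp_apply, restrict_apply, diff_apply]
    refine Ideal.sum_mem _ fun ℓ _ => Ideal.mul_mem_right _ _ ?_
    rw [mem_monomialIdeal]
    intro u hu
    refine ⟨ℓ, ?_⟩
    classical
    rw [coeff_monomial] at hu
    simp only [insert_empty_eq, sup_singleton, sup_empty] at hu
    split_ifs at hu with h
    · rw [← h, bot_eq_zero, tsub_zero]
    · exact absurd rfl hu

theorem ker_resDiff (i : ℕ) :
    LinearMap.ker (resDiff m K i) = LinearMap.range (resDiff m K (i + 1)) := by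
  ext x
  constructor
  · intro h
    rw [LinearMap.mem_ker] at h
    refine mem_range_resDiff m ?_ fun a L hL => ?_
    · rw [← extend_resDiff, h, map_zero]
    · have h0 : #L = i + 1 := by
        by_contra h0
        exact ne_zero_of_strand_ne_zero m hL (extend_of_card_ne x h0)
      obtain ⟨p, hp⟩ := card_pos.1 (by omega : 0 < #L)
      exact ⟨p, (le_sup hp).trans (sup_le_of_strand_ne_zero m hL)⟩
  · rintro ⟨y, rfl⟩
    rw [LinearMap.mem_ker, ← restrict_extend i (resDiff m K i _), extend_resDiff, extend_resDiff,
      diff_diff, map_zero]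

theorem resDiff_single (i : ℕ) (v : {L : Finset ι // #L = i + 1})
    (w : {L : Finset ι // #L = i}) :
    resDiff m K i (Finsupp.single v 1) w = ∑ ℓ ∈ w.1ᶜ with insert ℓ w.1 = v.1,
      monomial (v.1.sup m - w.1.sup m) (sgn K ℓ w.1) := by
  rw [resDiff, LinearMap.comp_apply, LinearMap.comp_apply, restrict_apply, diff_apply, sum_filter]
  refine sum_congr rfl fun ℓ _ => ?_
  rw [extend_single]
  split_ifs with h
  · rw [h, mul_one]
  · rw [mul_zero]

/-- The Taylor resolution, which is minimal when no generator divides the least common multiple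
of others. -/
noncomputable def taylorRes (K : Type) [Field K]
    (hm : ∀ (L : Finset ι) ℓ, ℓ ∉ L → ¬ m ℓ ≤ L.sup m) :
    Res (monomialIdeal K m) (fun i => {L : Finset ι // #L = i})
      (fun _ L => (L.1.sup m).degree) where
  d := resDiff m K
  aug := Finsupp.lapply ⟨∅, rfl⟩
  surj s := ⟨Finsupp.single ⟨∅, rfl⟩ s, by simp⟩
  exact_zero := aug_mem_iff m
  exact := ker_resDiff m
  graded i v w h := by
    rw [resDiff_single] at h ⊢
    obtain ⟨ℓ, hℓ, -⟩ := exists_ne_zero_of_sum_ne_zero h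
    have hle : w.1.sup m ≤ v.1.sup m := by
      rw [← (mem_filter.1 hℓ).2]; exact sup_le_sup_insert m _ _
    refine ⟨Finsupp.degree_mono hle, IsHomogeneous.sum _ _ _ fun ℓ _ =>
      isHomogeneous_monomial _ ?_⟩
    have := congrArg Finsupp.degree (tsub_add_cancel_of_le hle)
    rw [map_add] at this
    change _ = (v.1.sup m).degree - (w.1.sup m).degree
    omega
  graded_aug v := by
    obtain ⟨L, hL⟩ := v
    obtain rfl := card_eq_zero.1 hL
    simpa [bot_eq_zero] using isHomogeneous_one σ K
  minimal i v w := by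
    rw [resDiff_single, map_sum]
    refine sum_eq_zero fun ℓ hℓ => ?_
    rw [mem_filter, mem_compl] at hℓ
    classical
    rw [constantCoeff_monomial, if_neg]
    intro h
    refine hm w.1 ℓ hℓ.1 ((le_sup (f := m) (mem_insert_self ℓ w.1)).trans ?_)
    rw [hℓ.2]
    exact tsub_eq_zero_iff_le.1 h

end Taylor

namespace MinGradedFreeRes

open Finset GradedFree

variable {K : Type} [Field K] {σ : Type} {I : Ideal (MvPolynomial σ K)} {b : ℕ → ℕ → ℕ}

/-- A minimal graded free resolution, with its augmentation lifted to the polynomial ring. -/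
noncomputable def toRes (F : MinGradedFreeRes K σ I b) :
    Res I (fun i => Σ j : ℕ, Fin (b i j)) (fun _ v => v.1) :=
  have h : ∀ x, Ideal.Quotient.mk I (Finsupp.linearCombination (MvPolynomial σ K)
      (fun v => (F.graded_aug v).choose) x) = F.aug x := fun x => by
    induction x using Finsupp.induction_linear with
    | zero => simp
    | add x y hx hy => simp only [map_add, hx, hy]
    | single a p =>
      rw [single_eq_smul, map_smul F.aug, (F.graded_aug a).choose_spec.2, map_smul,
        Finsupp.linearCombination_single, one_smul]
      rfl
  { d := F.d
    aug := Finsupp.linearCombination _ fun v => (F.graded_aug v).choose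
    surj := fun s => by
      obtain ⟨x, hx⟩ := F.aug_surjective (Ideal.Quotient.mk I s)
      exact ⟨x, by rw [← Ideal.Quotient.eq, h, hx]⟩
    exact_zero := fun x => by
      rw [← Ideal.Quotient.eq_zero_iff_mem, h, ← F.exact_zero, LinearMap.mem_ker]
    exact := F.exact
    graded := F.graded
    graded_aug := fun v => by
      simpa using (F.graded_aug v).choose_spec.1
    minimal := F.minimal }

theorem finite_index (F : MinGradedFreeRes K σ I b) (i : ℕ) : Finite (Σ j : ℕ, Fin (b i j)) := by
  have := F.betti_finite.to_subtype
  refine Finite.of_injective (β := Σ p : Function.support fun p : ℕ × ℕ => b p.1 p.2,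
    Fin (b p.1.1 p.1.2)) (fun v => ⟨⟨(i, v.1), v.2.pos.ne'⟩, v.2⟩) ?_
  rintro ⟨j, x⟩ ⟨j', x'⟩ h
  obtain ⟨h1, h2⟩ := Sigma.mk.inj_iff.1 h
  obtain rfl : j = j' := congrArg (fun p => p.1.2) h1
  exact congrArg _ (eq_of_heq h2)

/-- The graded Betti numbers of a monomial ideal whose Taylor resolution is minimal. -/
theorem eq_card {ι : Type} [Fintype ι] {m : ι → σ →₀ ℕ}
    (hm : ∀ (L : Finset ι) ℓ, ℓ ∉ L → ¬ m ℓ ≤ L.sup m)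
    (F : MinGradedFreeRes K σ (Taylor.monomialIdeal K m) b) (i j : ℕ) :
    b i j = #{L : Finset ι | #L = i ∧ (L.sup m).degree = j} := by
  classical
  let : LinearOrder ι := LinearOrder.lift' (Fintype.equivFin ι) (Equiv.injective _)
  have := F.finite_index
  have := Fintype.ofFinite (Σ j : ℕ, Fin (b i j))
  have h := F.toRes.card_eq (Taylor.homogeneousComponent_mem_monomialIdeal m)
    (Taylor.taylorRes m K hm) i j
  have h1 : Fintype.card {v : Σ j : ℕ, Fin (b i j) // v.1 = j} = b i j := by
    rw [Fintype.card_congr (Equiv.sigmaSubtype j), Fintype.card_fin]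
  have h2 : Fintype.card {L : {L : Finset ι // #L = i} // (L.1.sup m).degree = j} =
      #{L : Finset ι | #L = i ∧ (L.sup m).degree = j} := by
    rw [← Fintype.card_subtype]
    exact Fintype.card_congr
      (Equiv.subtypeSubtypeEquivSubtypeInter (fun L : Finset ι => #L = i)
        fun L => (L.sup m).degree = j)
  rw [← h1, ← h2]
  convert h

end MinGradedFreeRes

namespace PathTree

open Finset

variable {k n : ℕ}

theorem pathEdge_injective (ℓ : TreeLeaf k n) : Function.Injective (pathEdge ℓ) :=
  fun _ _ h => congrArg Sigma.fst h

theorem eq_of_pathEdge_last_eq {ℓ ℓ' : TreeLeaf k (n + 1)} {i : Fin (n + 1)}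
    (h : pathEdge ℓ' i = pathEdge ℓ (Fin.last n)) : ℓ' = ℓ := by
  obtain rfl : i = Fin.last n := congrArg Sigma.fst h
  funext t
  exact congrFun (eq_of_heq (Sigma.mk.inj_iff.1 h).2) t

/-- The exponent of the monomial of the path of the leaf `ℓ`. -/
noncomputable def pathExp (ℓ : TreeLeaf k n) : TreeEdge k n →₀ ℕ :=
  ∑ i, Finsupp.single (pathEdge ℓ i) 1

theorem pathIdeal_eq (K : Type) [Field K] (k n : ℕ) :
    pathIdeal K k n = Taylor.monomialIdeal K (pathExp (k := k) (n := n)) := by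
  have h (ℓ : TreeLeaf k n) : pathMonomial K ℓ = monomial (pathExp ℓ) 1 := by
    rw [pathExp, monomial_sum_one]
    rfl
  rw [pathIdeal, Taylor.monomialIdeal, ← funext h]

/-- The edges on the paths from the root to the leaves in `L`. -/
def edges (L : Finset (TreeLeaf k n)) : Finset (TreeEdge k n) :=
  L.biUnion fun ℓ => univ.image (pathEdge ℓ)

theorem mem_edges {L : Finset (TreeLeaf k n)} {e : TreeEdge k n} :
    e ∈ edges L ↔ ∃ ℓ ∈ L, ∃ i, pathEdge ℓ i = e := by
  simp [edges]

theorem pathExp_apply (ℓ : TreeLeaf k n) (e : TreeEdge k n) :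
    pathExp ℓ e = if e ∈ univ.image (pathEdge ℓ) then 1 else 0 := by
  rw [pathExp, Finsupp.finsetSum_apply]
  simp only [Finsupp.single_apply]
  split_ifs with h
  · obtain ⟨i, -, rfl⟩ := mem_image.1 h
    simp [(pathEdge_injective ℓ).eq_iff]
  · refine sum_eq_zero fun i _ => if_neg fun hi => h ?_
    exact hi ▸ mem_image_of_mem _ (mem_univ i)

theorem sup_pathExp_apply (L : Finset (TreeLeaf k n)) (e : TreeEdge k n) :
    L.sup pathExp e = if e ∈ edges L then 1 else 0 := by
  induction L using Finset.induction with
  | empty => simp [edges, bot_eq_zero]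
  | insert ℓ L _ ih =>
    have hE : edges (insert ℓ L) = univ.image (pathEdge ℓ) ∪ edges L := biUnion_insert
    rw [sup_insert, Finsupp.sup_apply, ih, pathExp_apply, hE]
    simp only [mem_union]
    split_ifs <;> simp_all

theorem degree_sup_pathExp (L : Finset (TreeLeaf k n)) :
    (L.sup pathExp).degree = #(edges L) := by
  simp [Finsupp.degree_eq_sum, sup_pathExp_apply]

theorem not_pathExp_le_sup (L : Finset (TreeLeaf k (n + 1))) (ℓ) (h : ℓ ∉ L) :
    ¬ pathExp ℓ ≤ L.sup pathExp := by
  intro hle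
  have h1 := hle (pathEdge ℓ (Fin.last n))
  rw [pathExp_apply, if_pos (mem_image_of_mem _ (mem_univ _)), sup_pathExp_apply] at h1
  split_ifs at h1 with he
  · obtain ⟨ℓ', hℓ', i, hi⟩ := mem_edges.1 he
    exact h (eq_of_pathEdge_last_eq hi ▸ hℓ')
  · omega

/-- The edges of the tree of depth `n + 1`: for each child of the root, the edge to this child and
the edges below it. -/
def underEdge (p : Σ _ : Fin k, Option (TreeEdge k n)) : TreeEdge k (n + 1) :=
  match p with
  | ⟨c, none⟩ => ⟨0, fun _ => c⟩
  | ⟨c, some e⟩ => ⟨e.1.succ, Fin.cons c e.2⟩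

theorem underEdge_injective : Function.Injective (underEdge (k := k) (n := n)) := by
  rintro ⟨c, _ | ⟨i, f⟩⟩ ⟨c', _ | ⟨i', f'⟩⟩ h
  · obtain rfl : c = c' := congrArg (fun e : TreeEdge k (n + 1) => e.2 0) h
    rfl
  · exact absurd (congrArg Sigma.fst h) (Fin.succ_ne_zero _).symm
  · exact absurd (congrArg Sigma.fst h) (Fin.succ_ne_zero _)
  · obtain rfl : i = i' := Fin.succ_injective _ (congrArg Sigma.fst h)
    obtain ⟨rfl, rfl⟩ := Fin.cons_inj.1 (eq_of_heq (Sigma.mk.inj_iff.1 h).2)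
    rfl

theorem pathEdge_cons_zero (c : Fin k) (ℓ : TreeLeaf k n) :
    pathEdge (Fin.cons c ℓ : TreeLeaf k (n + 1)) 0 = underEdge ⟨c, none⟩ := by
  refine Sigma.ext rfl (heq_of_eq ?_)
  funext t
  obtain rfl : t = 0 := Fin.fin_one_eq_zero t
  rfl

theorem pathEdge_cons_succ (c : Fin k) (ℓ : TreeLeaf k n) (i : Fin n) :
    pathEdge (Fin.cons c ℓ : TreeLeaf k (n + 1)) i.succ = underEdge ⟨c, some (pathEdge ℓ i)⟩ := by
  refine Sigma.ext rfl (heq_of_eq ?_)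
  funext t
  refine Fin.cases rfl (fun t => rfl) t

/-- A set of leaves of the tree of depth `n + 1` is a family of sets of leaves below the children
of the root. -/
def glue : (Fin k → Finset (TreeLeaf k n)) ≃ Finset (TreeLeaf k (n + 1)) where
  toFun M := {ℓ | Fin.tail ℓ ∈ M (ℓ 0)}
  invFun L c := {ℓ | (Fin.cons c ℓ : TreeLeaf k (n + 1)) ∈ L}
  left_inv M := by
    ext c ℓ
    simp
  right_inv L := by
    ext ℓ
    simp

theorem glue_eq_image (M : Fin k → Finset (TreeLeaf k n)) :
    glue M = (univ.sigma M).image fun p => Fin.cons p.1 p.2 := by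
  ext ℓ
  simp only [glue, Equiv.coe_fn_mk, mem_filter, mem_univ, true_and, mem_image, mem_sigma]
  constructor
  · exact fun h => ⟨⟨ℓ 0, Fin.tail ℓ⟩, h, Fin.cons_self_tail ℓ⟩
  · rintro ⟨p, hp, rfl⟩
    simpa using hp

theorem card_glue (M : Fin k → Finset (TreeLeaf k n)) : #(glue M) = ∑ c, #(M c) := by
  rw [glue_eq_image, card_image_of_injOn, card_sigma]
  rintro ⟨c, ℓ⟩ - ⟨c', ℓ'⟩ - h
  obtain ⟨rfl, rfl⟩ := Fin.cons_inj.1 h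
  rfl

theorem edges_glue (M : Fin k → Finset (TreeLeaf k n)) :
    edges (glue M) = (univ.sigma fun c => if (M c).Nonempty then insertNone (edges (M c))
      else ∅).image underEdge := by
  ext e
  rw [mem_edges, glue_eq_image]
  simp only [mem_image, mem_sigma, mem_univ, true_and]
  constructor
  · rintro ⟨_, ⟨⟨c, ℓ⟩, hℓ, rfl⟩, i, rfl⟩
    have hne : (M c).Nonempty := ⟨ℓ, hℓ⟩
    cases i using Fin.cases with
    | zero => exact ⟨⟨c, none⟩, by simp [hne], (pathEdge_cons_zero c ℓ).symm⟩
    | succ i =>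
      refine ⟨⟨c, some (pathEdge ℓ i)⟩, ?_, (pathEdge_cons_succ c ℓ i).symm⟩
      rw [if_pos hne, some_mem_insertNone]
      exact mem_edges.2 ⟨ℓ, hℓ, i, rfl⟩
  · rintro ⟨⟨c, e⟩, he, rfl⟩
    split_ifs at he with hne
    · cases e with
      | none =>
        obtain ⟨ℓ, hℓ⟩ := hne
        exact ⟨_, ⟨⟨c, ℓ⟩, hℓ, rfl⟩, 0, pathEdge_cons_zero c ℓ⟩
      | some e =>
        obtain ⟨ℓ, hℓ, i, rfl⟩ := mem_edges.1 (some_mem_insertNone.1 he)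
        exact ⟨_, ⟨⟨c, ℓ⟩, hℓ, rfl⟩, i.succ, pathEdge_cons_succ c ℓ i⟩
    · simp at he

theorem card_edges_glue (M : Fin k → Finset (TreeLeaf k n)) :
    #(edges (glue M)) = ∑ c, if (M c).Nonempty then #(edges (M c)) + 1 else 0 := by
  rw [edges_glue, card_image_of_injective _ underEdge_injective, card_sigma]
  refine sum_congr rfl fun c _ => ?_
  split_ifs
  · exact card_insertNone _
  · exact card_empty

/-- The monomial `x ^ |L| t ^ |E|`, where `E` is the set of edges on the paths to `L`. -/
noncomputable def weight (L : Finset (TreeLeaf k n)) : MvPolynomial (Fin 2) ℤ :=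
  X 0 ^ #L * X 1 ^ #(edges L)

theorem weight_glue (M : Fin k → Finset (TreeLeaf k n)) :
    weight (glue M) = ∏ c, if (M c).Nonempty then X 1 * weight (M c) else 1 := by
  rw [weight, card_glue, card_edges_glue, ← prod_pow_eq_pow_sum, ← prod_pow_eq_pow_sum,
    ← prod_mul_distrib]
  refine prod_congr rfl fun c _ => ?_
  split_ifs with h
  · rw [weight]
    ring
  · simp [not_nonempty_iff_eq_empty.1 h]

/-- The generating function of the nonempty sets of leaves. -/
noncomputable def leafGenFun (k n : ℕ) : MvPolynomial (Fin 2) ℤ :=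
  ∑ L : Finset (TreeLeaf k n) with L.Nonempty, weight L

theorem one_add_leafGenFun (k n : ℕ) :
    1 + leafGenFun k n = ∑ L : Finset (TreeLeaf k n), weight L := by
  rw [leafGenFun, ← sum_filter_not_add_sum_filter univ Finset.Nonempty (weight (k := k) (n := n))]
  congr 1
  simp [not_nonempty_iff_eq_empty, filter_eq', weight, edges]

theorem leafGenFun_zero (k : ℕ) : leafGenFun k 0 = X 0 := by
  have h : ({L : Finset (TreeLeaf k 0) | L.Nonempty} : Finset _) = {{Fin.elim0}} := by
    ext L
    rw [mem_filter_univ, mem_singleton]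
    refine ⟨fun h => ?_, fun h => h ▸ singleton_nonempty _⟩
    exact eq_singleton_iff_nonempty_unique_mem.2 ⟨h, fun _ _ => Subsingleton.elim _ _⟩
  rw [leafGenFun, h, sum_singleton, weight, card_singleton, edges]
  simp

theorem leafGenFun_succ (k n : ℕ) :
    leafGenFun k (n + 1) = (1 + X 1 * leafGenFun k n) ^ k - 1 := by
  rw [eq_sub_iff_add_eq', one_add_leafGenFun, ← glue.sum_comp]
  have h : 1 + X 1 * leafGenFun k n =
      ∑ L : Finset (TreeLeaf k n), if L.Nonempty then X 1 * weight L else 1 := by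
    rw [sum_ite, leafGenFun, mul_sum, add_comm]
    simp [not_nonempty_iff_eq_empty, filter_eq']
  rw [h, Fintype.sum_pow]
  exact sum_congr rfl fun M _ => weight_glue M

theorem edges_nonempty {L : Finset (TreeLeaf k (n + 1))} (h : L.Nonempty) : (edges L).Nonempty :=
  h.elim fun ℓ hℓ => ⟨_, mem_edges.2 ⟨ℓ, hℓ, 0, rfl⟩⟩

theorem bettiGenFun_eq_leafGenFun {b : ℕ → ℕ → ℕ}
    (h : ∀ i j, b i j = #{L : Finset (TreeLeaf k (n + 1)) | #L = i ∧ #(edges L) = j}) :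
    bettiGenFun b = leafGenFun k (n + 1) := by
  have key (p : ℕ × ℕ) : (b (p.1 + 1) (p.2 + 1) : ℤ) •
      (X (0 : Fin 2) ^ (p.1 + 1) * X (1 : Fin 2) ^ (p.2 + 1) : MvPolynomial (Fin 2) ℤ) =
      ∑ L : Finset (TreeLeaf k (n + 1)) with L.Nonempty,
        if p = (#L - 1, #(edges L) - 1) then weight L else 0 := by
    have hset : ({L | #L = p.1 + 1 ∧ #(edges L) = p.2 + 1} :
        Finset (Finset (TreeLeaf k (n + 1)))) =
        ({L | L.Nonempty ∧ p = (#L - 1, #(edges L) - 1)} : Finset _) := by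
      refine filter_congr fun L _ => ?_
      rw [← card_pos, Prod.ext_iff]
      constructor
      · rintro ⟨h1, h2⟩
        exact ⟨by omega, by simp [h1], by simp [h2]⟩
      · rintro ⟨h1, h2, h3⟩
        have := (edges_nonempty (card_pos.1 h1)).card_pos
        simp only at h2 h3
        omega
    rw [← sum_filter, filter_filter, ← hset, h, natCast_zsmul, ← sum_const]
    refine sum_congr rfl fun L hL => ?_
    obtain ⟨h1, h2⟩ := (mem_filter.1 hL).2
    rw [weight, h1, h2]
  rw [bettiGenFun, finsum_congr key, finsum_sum_comm, leafGenFun]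
  · exact sum_congr rfl fun L _ => by
      rw [finsum_eq_single _ (#L - 1, #(edges L) - 1) fun p hp => if_neg hp, if_pos rfl]
  · exact fun L _ => (Set.finite_singleton (#L - 1, #(edges L) - 1)).subset fun p hp => by
      by_contra hne
      exact hp (if_neg hne)

theorem bettiGenFun_eq {K : Type} [Field K] {b : ℕ → ℕ → ℕ}
    (F : MinGradedFreeRes K (TreeEdge k (n + 1)) (pathIdeal K k (n + 1)) b) :
    bettiGenFun b = leafGenFun k (n + 1) := by
  rw [pathIdeal_eq] at F
  refine bettiGenFun_eq_leafGenFun fun i j => ?_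
  simp only [F.eq_card not_pathExp_le_sup i j, degree_sup_pathExp]

end PathTree

/-- The generating function `G_{k,n}(x,t)` of the graded Betti numbers of the path
ideal of the complete `k`-ary tree satisfies the recursion
`G_{k,n}(x,t) = (1 + t G_{k,n-1}(x,t))^k - 1` for `n ≥ 2`, with initial condition
`G_{k,1}(x,t) = (1 + t x)^k - 1`. -/
theorem pathIdeal_bettiGenFun_recursion (K : Type) [Field K] (k : ℕ) (hk : 1 ≤ k) :
    (∀ n : ℕ, 2 ≤ n → ∀ b b' : ℕ → ℕ → ℕ,
      MinGradedFreeRes K (TreeEdge k n) (pathIdeal K k n) b →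
      MinGradedFreeRes K (TreeEdge k (n - 1)) (pathIdeal K k (n - 1)) b' →
      bettiGenFun b = (1 + X (1 : Fin 2) * bettiGenFun b') ^ k - 1) ∧
    (∀ b : ℕ → ℕ → ℕ,
      MinGradedFreeRes K (TreeEdge k 1) (pathIdeal K k 1) b →
      bettiGenFun b = (1 + X (1 : Fin 2) * X (0 : Fin 2)) ^ k - 1) := by
  refine ⟨fun n hn b b' F F' => ?_, fun b F => ?_⟩
  · obtain ⟨n, rfl⟩ := Nat.exists_eq_add_of_le' hn
    rw [PathTree.bettiGenFun_eq F, PathTree.bettiGenFun_eq (n := n) F', PathTree.leafGenFun_succ]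
  · rw [PathTree.bettiGenFun_eq (n := 0) F, PathTree.leafGenFun_succ, PathTree.leafGenFun_zero]
end

section
/- For k = 2, the critical value q*_2 of the cut bound recursion C_{n}(q) = (C_{n-1}(q)+q)^2 equals 1/4: for 0 <= q <= 1/4 the iterates converge to the smallest root (1 - 2q - sqrt(1-4q))/2 of z = (z+q)^2, and for q > 1/4 they diverge to infinity. -/
open Filter Topology

/-- The first cut bound for `k = 2`: `C_1(q) = q^2`, `C_n(q) = (C_{n-1}(q)+q)^2`.
Here `cutBound2 q m` is `C_{m+1}(q)`. -/
noncomputable def cutBound2 (q : ℝ) : ℕ → ℝ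
  | 0 => q ^ 2
  | m + 1 => (cutBound2 q m + q) ^ 2

lemma cutBound2_nonneg (q : ℝ) (n : ℕ) : 0 ≤ cutBound2 q n := by
  cases n <;> exact sq_nonneg _

lemma cutBound2_monotone {q : ℝ} (hq : 0 ≤ q) : Monotone (cutBound2 q) := by
  refine monotone_nat_of_le_succ fun n => ?_
  induction n with
  | zero =>
    exact pow_le_pow_left₀ hq (le_add_of_nonneg_left (cutBound2_nonneg q 0)) 2
  | succ n ih =>
    exact pow_le_pow_left₀ (add_nonneg (cutBound2_nonneg q n) hq) (by gcongr) 2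

lemma cutBound2_le_of_fixedPoint {q z : ℝ} (hq : 0 ≤ q) (hz : z = (z + q) ^ 2) (n : ℕ) :
    cutBound2 q n ≤ z := by
  have hz0 : 0 ≤ z := hz ▸ sq_nonneg _
  induction n with
  | zero =>
    rw [hz]
    exact pow_le_pow_left₀ hq (le_add_of_nonneg_left hz0) 2
  | succ n ih =>
    rw [hz]
    exact pow_le_pow_left₀ (add_nonneg (cutBound2_nonneg q n) hq) (by gcongr) 2

lemma fixedPoint_of_tendsto_cutBound2 {q l : ℝ} (h : Tendsto (cutBound2 q) atTop (𝓝 l)) :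
    l = (l + q) ^ 2 :=
  tendsto_nhds_unique ((tendsto_add_atTop_iff_nat 1).2 h) ((h.add_const q).pow 2)

lemma tendsto_cutBound2_of_isLeast {q z : ℝ} (hq : 0 ≤ q)
    (hz : IsLeast {z : ℝ | z = (z + q) ^ 2} z) : Tendsto (cutBound2 q) atTop (𝓝 z) := by
  have hle := cutBound2_le_of_fixedPoint hq hz.1
  have hlim := tendsto_atTop_ciSup (cutBound2_monotone hq) ⟨z, Set.forall_mem_range.2 hle⟩
  rwa [le_antisymm (ciSup_le hle) (hz.2 (fixedPoint_of_tendsto_cutBound2 hlim))] at hlim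

lemma isLeast_fixedPoint {q : ℝ} (hq : q ≤ 1 / 4) :
    IsLeast {z : ℝ | z = (z + q) ^ 2} ((1 - 2 * q - Real.sqrt (1 - 4 * q)) / 2) := by
  have hs : Real.sqrt (1 - 4 * q) ^ 2 = 1 - 4 * q := Real.sq_sqrt (by linarith)
  refine ⟨?_, fun z hz => ?_⟩
  · rw [Set.mem_ofPred_eq]
    linear_combination (-1 / 4) * hs
  · rw [Set.mem_ofPred_eq] at hz
    have h : 1 - 2 * q - 2 * z ≤ Real.sqrt (1 - 4 * q) :=
      Real.le_sqrt_of_sq_le (by linarith)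
    linarith

lemma mul_le_cutBound2 (q : ℝ) (n : ℕ) : n * (q - 1 / 4) ≤ cutBound2 q n := by
  induction n with
  | zero => simpa using cutBound2_nonneg q 0
  | succ n ih =>
    rw [cutBound2]
    push_cast
    linarith [sq_nonneg (cutBound2 q n + q - 1 / 2)]

/-- For `k = 2` the critical value of the cut bound recursion is `q*_2 = 1/4`:
for `0 ≤ q ≤ 1/4` the iterates converge to the smallest root
`(1 - 2q - √(1-4q))/2` of `z = (z+q)^2`, and for `q > 1/4` they diverge to `∞`. -/
theorem cutBound2_critical (q : ℝ) :
    (0 ≤ q → q ≤ 1 / 4 →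
      IsLeast {z : ℝ | z = (z + q) ^ 2} ((1 - 2 * q - Real.sqrt (1 - 4 * q)) / 2) ∧
      Tendsto (cutBound2 q) atTop
        (nhds ((1 - 2 * q - Real.sqrt (1 - 4 * q)) / 2))) ∧
    (1 / 4 < q → Tendsto (cutBound2 q) atTop atTop) := by
  refine ⟨fun h0 h1 => ⟨isLeast_fixedPoint h1,
    tendsto_cutBound2_of_isLeast h0 (isLeast_fixedPoint h1)⟩, fun h => ?_⟩
  exact tendsto_atTop_mono (mul_le_cutBound2 q)
    (tendsto_natCast_atTop_atTop.atTop_mul_const (sub_pos.2 h))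
end

section
/- The asymptotic graded Betti numbers of the cut ideal of the infinite binary tree are beta_{i,j}(J_{2,∞}) = (2(j-i))! / ((j-i+1)(j-i)(j-i)!(j-2i)!(i-1)!) for j >= 2i, and 0 otherwise; equivalently beta_{i,i+j}(J_{2,∞}) = c_j * binomial(j-1, i-1), where c_j is the j-th Catalan number. -/
open MvPolynomial

/-- `C` is a cut of the complete `k`-ary tree: every root-to-leaf path meets `C`. -/
def TreeIsCut {k n : ℕ} (C : Finset (TreeEdge k n)) : Prop :=
  ∀ ℓ : TreeLeaf k n, ∃ i : Fin n, pathEdge ℓ i ∈ C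

/-- `C` is a minimal cut of the complete `k`-ary tree. -/
def TreeMinCut {k n : ℕ} (C : Finset (TreeEdge k n)) : Prop :=
  TreeIsCut C ∧ ∀ C' ⊆ C, TreeIsCut C' → C' = C

/-- The cut ideal `J_{k,n}` of the complete `k`-ary tree (the Alexander dual of
the path ideal): it is generated by the squarefree monomials of minimal cuts. -/
noncomputable def cutIdeal (K : Type) [Field K] (k n : ℕ) :
    Ideal (MvPolynomial (TreeEdge k n) K) :=
  Ideal.span { m | ∃ C : Finset (TreeEdge k n), TreeMinCut C ∧ m = ∏ e ∈ C, X e }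

section GradedFree

variable {K : Type} [Field K] {σ : Type}

/-- All monomials of `p`, placed on a basis element of degree `c`, have total degree `n`. -/
def DegEq (p : MvPolynomial σ K) (c n : ℕ) : Prop :=
  ∀ m, coeff m p ≠ 0 → m.degree + c = n

/-- The element `x` of a graded free module is homogeneous of degree `n`. -/
def HomEl {ι : Type} (deg : ι → ℕ) (n : ℕ) (x : ι →₀ MvPolynomial σ K) : Prop :=
  ∀ w, DegEq (x w) (deg w) n

lemma DegEq.zero (c n : ℕ) : DegEq (0 : MvPolynomial σ K) c n := by
  intro m hm
  simp at hm

lemma DegEq.neg {p : MvPolynomial σ K} {c n : ℕ} (hp : DegEq p c n) : DegEq (-p) c n := by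
  intro m hm
  exact hp m (by simpa using hm)

lemma DegEq.sum {α : Type} {s : Finset α} {f : α → MvPolynomial σ K} {c n : ℕ}
    (h : ∀ a ∈ s, DegEq (f a) c n) : DegEq (∑ a ∈ s, f a) c n := by
  intro m hm
  rw [coeff_sum] at hm
  obtain ⟨a, ha, hne⟩ := Finset.exists_ne_zero_of_sum_ne_zero hm
  exact h a ha m hne

lemma DegEq.mul {p q : MvPolynomial σ K} {a b c : ℕ} (hp : DegEq p b c) (hq : DegEq q a b) :
    DegEq (p * q) a c := by
  classical
  intro m hm
  rw [coeff_mul] at hm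
  obtain ⟨x, hx, hne⟩ := Finset.exists_ne_zero_of_sum_ne_zero hm
  have h1 := hp _ (left_ne_zero_of_mul hne)
  have h2 := hq _ (right_ne_zero_of_mul hne)
  rw [Finset.HasAntidiagonal.mem_antidiagonal] at hx
  rw [← hx, map_add]
  omega

lemma DegEq.shift {p : MvPolynomial σ K} {c n : ℕ} (hp : DegEq p c n) (s : ℕ) :
    DegEq p (c + s) (n + s) := by
  intro m hm
  have := hp m hm
  omega

lemma degEq_one (c : ℕ) : DegEq (1 : MvPolynomial σ K) c c := by
  classical
  intro m hm
  rw [coeff_one] at hm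
  have : m = 0 := by
    by_contra h
    simp [Ne.symm h] at hm
  simp [this]

lemma DegEq.constantCoeff_eq_zero {p : MvPolynomial σ K} {c n : ℕ} (hp : DegEq p c n)
    (h : c ≠ n) : constantCoeff p = 0 := by
  by_contra hne
  have := hp 0 (by simpa [constantCoeff_eq] using hne)
  simp at this
  exact h this

lemma map_eq_sum_single {ι : Type} {M : Type} [AddCommGroup M] [Module (MvPolynomial σ K) M]
    (f : (ι →₀ MvPolynomial σ K) →ₗ[MvPolynomial σ K] M) (x : ι →₀ MvPolynomial σ K) :
    f x = ∑ v ∈ x.support, x v • f (Finsupp.single v 1) := by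
  conv_lhs => rw [← Finsupp.sum_single x]
  rw [Finsupp.sum, map_sum]
  refine Finset.sum_congr rfl fun v _ => ?_
  rw [← map_smul, Finsupp.smul_single, smul_eq_mul, mul_one]

lemma HomEl.map {ι κ : Type} {degι : ι → ℕ} {degκ : κ → ℕ} {s n : ℕ}
    {f : (ι →₀ MvPolynomial σ K) →ₗ[MvPolynomial σ K] (κ →₀ MvPolynomial σ K)}
    (hf : ∀ v, HomEl degκ (degι v + s) (f (Finsupp.single v 1)))
    {x : ι →₀ MvPolynomial σ K} (hx : HomEl degι n x) : HomEl degκ (n + s) (f x) := by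
  intro w
  rw [map_eq_sum_single, Finsupp.finsetSum_apply]
  exact DegEq.sum fun v _ => ((hx v).shift s).mul (hf v w)

lemma HomEl.map_zero {ι : Type} {degι : ι → ℕ} {n : ℕ}
    {f : (ι →₀ MvPolynomial σ K) →ₗ[MvPolynomial σ K] MvPolynomial σ K}
    (hf : ∀ v, DegEq (f (Finsupp.single v 1)) 0 (degι v))
    {x : ι →₀ MvPolynomial σ K} (hx : HomEl degι n x) : DegEq (f x) 0 n := by
  rw [map_eq_sum_single]
  exact DegEq.sum fun v _ => (hx v).mul (hf v)

/-- The part of degree `n` of `p` placed on a basis element of degree `c`. -/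
noncomputable def shiftPart (c n : ℕ) : MvPolynomial σ K →ₗ[K] MvPolynomial σ K :=
  if c ≤ n then (homogeneousComponent (n - c)) else 0

lemma coeff_shiftPart (c n : ℕ) (p : MvPolynomial σ K) (m : σ →₀ ℕ) :
    coeff m (shiftPart c n p) = if m.degree + c = n then coeff m p else 0 := by
  unfold shiftPart
  split_ifs with h h' h'
  · rw [coeff_homogeneousComponent, if_pos (by omega)]
  · rw [coeff_homogeneousComponent, if_neg (by omega)]
  · omega
  · simp

lemma degEq_shiftPart (c n : ℕ) (p : MvPolynomial σ K) : DegEq (shiftPart c n p) c n := by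
  intro m hm
  rw [coeff_shiftPart] at hm
  by_contra h
  simp [h] at hm

lemma shiftPart_of_degEq {c n : ℕ} {p : MvPolynomial σ K} (hp : DegEq p c n) :
    shiftPart c n p = p := by
  ext m
  rw [coeff_shiftPart]
  split_ifs with h
  · rfl
  · by_contra h'
    exact h (hp m (Ne.symm h'))

lemma shiftPart_mul {c b n : ℕ} {p q : MvPolynomial σ K} (hq : DegEq q c b) :
    shiftPart c n (p * q) = shiftPart b n p * q := by
  classical
  ext m
  rw [coeff_shiftPart, coeff_mul, coeff_mul]
  split_ifs with h
  · refine Finset.sum_congr rfl fun x hx => ?_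
    rw [Finset.HasAntidiagonal.mem_antidiagonal] at hx
    rw [coeff_shiftPart]
    split_ifs with h'
    · rfl
    · have : coeff x.2 q = 0 := by
        by_contra hne
        have := hq _ hne
        rw [← hx, map_add] at h
        omega
      simp [this]
  · symm
    refine Finset.sum_eq_zero fun x hx => ?_
    rw [Finset.HasAntidiagonal.mem_antidiagonal] at hx
    rw [coeff_shiftPart]
    split_ifs with h'
    · have : coeff x.2 q = 0 := by
        by_contra hne
        have := hq _ hne
        rw [← hx, map_add] at h
        omega
      simp [this]
    · simp

/-- The component of degree `n` of an element of a graded free module. -/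
noncomputable def gradedPart {ι : Type} (deg : ι → ℕ) (n : ℕ) (x : ι →₀ MvPolynomial σ K) :
    ι →₀ MvPolynomial σ K :=
  Finsupp.onFinset x.support (fun w => shiftPart (deg w) n (x w)) fun w hw => by
    rw [Finsupp.mem_support_iff]
    intro h
    simp [h] at hw

lemma homEl_gradedPart {ι : Type} (deg : ι → ℕ) (n : ℕ) (x : ι →₀ MvPolynomial σ K) :
    HomEl deg n (gradedPart deg n x) := fun _ => degEq_shiftPart _ _ _

lemma map_gradedPart {ι : Type} {deg : ι → ℕ} {c n : ℕ}
    {f : (ι →₀ MvPolynomial σ K) →ₗ[MvPolynomial σ K] MvPolynomial σ K}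
    (hf : ∀ v, DegEq (f (Finsupp.single v 1)) c (deg v)) (x : ι →₀ MvPolynomial σ K) :
    f (gradedPart deg n x) = shiftPart c n (f x) := by
  rw [map_eq_sum_single f x, map_sum, map_eq_sum_single f]
  have hsub : (gradedPart deg n x).support ⊆ x.support := Finsupp.support_onFinset_subset
  rw [Finset.sum_subset hsub]
  · refine Finset.sum_congr rfl fun v _ => ?_
    rw [smul_eq_mul, smul_eq_mul, shiftPart_mul (hf v)]
    rfl
  · intro v _ hv
    rw [Finsupp.notMem_support_iff.mp hv, zero_smul]

lemma exists_homEl_preimage {ι κ : Type} {degι : ι → ℕ} {degκ : κ → ℕ} {n : ℕ}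
    {f : (ι →₀ MvPolynomial σ K) →ₗ[MvPolynomial σ K] (κ →₀ MvPolynomial σ K)}
    (hf : ∀ v, HomEl degκ (degι v) (f (Finsupp.single v 1)))
    {y : κ →₀ MvPolynomial σ K} (hy : HomEl degκ n y) (hr : y ∈ LinearMap.range f) :
    ∃ x, HomEl degι n x ∧ f x = y := by
  obtain ⟨x, rfl⟩ := hr
  refine ⟨gradedPart degι n x, homEl_gradedPart _ _ _, ?_⟩
  ext1 w
  have := map_gradedPart (deg := degι) (c := degκ w) (n := n) (f := Finsupp.lapply w ∘ₗ f)
    (fun v => hf v w) x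
  simp only [LinearMap.comp_apply, Finsupp.lapply_apply] at this
  rw [this, shiftPart_of_degEq (hy w)]

variable (K σ) in
/-- A minimal graded free resolution of the quotient by `I`, with augmentation lifted to the
polynomial ring. -/
structure GradedRes (I : Ideal (MvPolynomial σ K)) where
  ι : ℕ → Type
  deg : ∀ i, ι i → ℕ
  d : ∀ i, (ι (i + 1) →₀ MvPolynomial σ K) →ₗ[MvPolynomial σ K] (ι i →₀ MvPolynomial σ K)
  ε : (ι 0 →₀ MvPolynomial σ K) →ₗ[MvPolynomial σ K] MvPolynomial σ K
  one : ∃ y, HomEl (deg 0) 0 y ∧ ε y - 1 ∈ I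
  exact_zero : ∀ x, ε x ∈ I ↔ x ∈ LinearMap.range (d 0)
  exact : ∀ i x, d i x = 0 ↔ x ∈ LinearMap.range (d (i + 1))
  graded_aug : ∀ v, DegEq (ε (Finsupp.single v 1)) 0 (deg 0 v)
  graded : ∀ i v, HomEl (deg i) (deg (i + 1) v) (d i (Finsupp.single v 1))
  minimal : ∀ i v w, constantCoeff (d i (Finsupp.single v 1) w) = 0

namespace GradedRes

variable {I I' : Ideal (MvPolynomial σ K)}

lemma d_comp_d (F : GradedRes K σ I) (i : ℕ) (x : F.ι (i + 2) →₀ MvPolynomial σ K) :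
    F.d i (F.d (i + 1) x) = 0 :=
  (F.exact i _).mpr ⟨x, rfl⟩

lemma exists_lift_step (F : GradedRes K σ I) (G : GradedRes K σ I') (s i : ℕ)
    (ψ : (G.ι i →₀ MvPolynomial σ K) →ₗ[MvPolynomial σ K] (F.ι i →₀ MvPolynomial σ K))
    (hψ : ∀ v, HomEl (F.deg i) (G.deg i v + s) (ψ (Finsupp.single v 1)))
    (hr : ∀ x, ψ (G.d i x) ∈ LinearMap.range (F.d i)) :
    ∃ φ : (G.ι (i + 1) →₀ MvPolynomial σ K) →ₗ[MvPolynomial σ K]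
      (F.ι (i + 1) →₀ MvPolynomial σ K),
      (∀ v, HomEl (F.deg (i + 1)) (G.deg (i + 1) v + s) (φ (Finsupp.single v 1))) ∧
      (∀ x, F.d i (φ x) = ψ (G.d i x)) ∧
      ∀ x, φ (G.d (i + 1) x) ∈ LinearMap.range (F.d (i + 1)) := by
  have key : ∀ v : G.ι (i + 1), ∃ y, HomEl (F.deg (i + 1)) (G.deg (i + 1) v + s) y ∧
      F.d i y = ψ (G.d i (Finsupp.single v 1)) := fun v =>
    exists_homEl_preimage (F.graded i) (HomEl.map hψ (G.graded i v)) (hr _)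
  choose y hy hdy using key
  have hcomm : F.d i ∘ₗ Finsupp.linearCombination _ y = ψ ∘ₗ G.d i := by
    refine Finsupp.lhom_ext' fun v => LinearMap.ext_ring ?_
    simp [hdy]
  have hcomm' : ∀ x, F.d i (Finsupp.linearCombination _ y x) = ψ (G.d i x) :=
    fun x => LinearMap.congr_fun hcomm x
  refine ⟨Finsupp.linearCombination _ y, fun v => by simpa using hy v, hcomm', fun x => ?_⟩
  rw [← F.exact, hcomm', G.d_comp_d, map_zero]

/-- Multiplication by `r` lifts to a graded map of resolutions. -/
theorem exists_lift (F : GradedRes K σ I) (G : GradedRes K σ I') {r : MvPolynomial σ K} {s : ℕ}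
    (hr : DegEq r 0 s) (hI : ∀ a ∈ I', r * a ∈ I) :
    ∃ φ : ∀ i, (G.ι i →₀ MvPolynomial σ K) →ₗ[MvPolynomial σ K] (F.ι i →₀ MvPolynomial σ K),
      (∀ i v, HomEl (F.deg i) (G.deg i v + s) (φ i (Finsupp.single v 1))) ∧
      (∀ x, F.ε (φ 0 x) - r * G.ε x ∈ I) ∧
      ∀ i x, F.d i (φ (i + 1) x) = φ i (G.d i x) := by
  obtain ⟨y, hy, hy1⟩ := F.one
  let P : ∀ i, ((G.ι i →₀ MvPolynomial σ K) →ₗ[MvPolynomial σ K]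
      (F.ι i →₀ MvPolynomial σ K)) → Prop := fun i ψ =>
    (∀ v, HomEl (F.deg i) (G.deg i v + s) (ψ (Finsupp.single v 1))) ∧
      ∀ x, ψ (G.d i x) ∈ LinearMap.range (F.d i)
  let φ₀ : (G.ι 0 →₀ MvPolynomial σ K) →ₗ[MvPolynomial σ K] (F.ι 0 →₀ MvPolynomial σ K) :=
    (r • G.ε).smulRight y
  have hε : ∀ x, F.ε (φ₀ x) - r * G.ε x ∈ I := by
    intro x
    have : F.ε (φ₀ x) - r * G.ε x = (r * G.ε x) * (F.ε y - 1) := by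
      simp only [φ₀, LinearMap.smulRight_apply, LinearMap.smul_apply, map_smul, smul_eq_mul]
      ring
    rw [this]
    exact I.mul_mem_left _ hy1
  have h₀ : P 0 φ₀ := by
    refine ⟨fun v w => ?_, fun x => ?_⟩
    · have hG : DegEq (r * G.ε (Finsupp.single v 1)) 0 (G.deg 0 v + s) := by
        rw [mul_comm]
        exact ((G.graded_aug v).shift s).mul (by simpa using hr)
      simpa [φ₀] using hG.mul (hy w)
    · rw [← F.exact_zero]
      have h1 := hε (G.d 0 x)
      have h2 := hI _ ((G.exact_zero (G.d 0 x)).mpr ⟨x, rfl⟩)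
      simpa using I.add_mem h1 h2
  have hstep : ∀ i (ψ : { ψ // P i ψ }), ∃ φ : { φ // P (i + 1) φ },
      ∀ x, F.d i (φ.1 x) = ψ.1 (G.d i x) := by
    rintro i ⟨ψ, hψ, hψ'⟩
    obtain ⟨φ, h1, h2, h3⟩ := exists_lift_step F G s i ψ hψ hψ'
    exact ⟨⟨φ, h1, h3⟩, h2⟩
  choose step hstep using hstep
  let Φ : ∀ i, { ψ // P i ψ } := fun i => Nat.rec ⟨φ₀, h₀⟩ step i
  exact ⟨fun i => (Φ i).1, fun i => (Φ i).2.1, hε, fun i => hstep i (Φ i)⟩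

lemma constantCoeff_d (F : GradedRes K σ I) (i : ℕ) (x : F.ι (i + 1) →₀ MvPolynomial σ K)
    (w : F.ι i) : constantCoeff (F.d i x w) = 0 := by
  rw [map_eq_sum_single, Finsupp.finsetSum_apply, map_sum]
  refine Finset.sum_eq_zero fun v _ => ?_
  rw [Finsupp.smul_apply, smul_eq_mul, map_mul, F.minimal, mul_zero]

/-- A linear map that vanishes modulo the variables on the image of a minimal differential. -/
lemma constantCoeff_map {ι κ : Type}
    (f : (ι →₀ MvPolynomial σ K) →ₗ[MvPolynomial σ K] (κ →₀ MvPolynomial σ K))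
    (x : ι →₀ MvPolynomial σ K) (hx : ∀ v, constantCoeff (x v) = 0) (w : κ) :
    constantCoeff (f x w) = 0 := by
  rw [map_eq_sum_single, Finsupp.finsetSum_apply, map_sum]
  refine Finset.sum_eq_zero fun v _ => ?_
  rw [Finsupp.smul_apply, smul_eq_mul, map_mul, hx, zero_mul]

lemma exists_factor (F : GradedRes K σ I) (i : ℕ) {ι : Type}
    (f : (ι →₀ MvPolynomial σ K) →ₗ[MvPolynomial σ K] (F.ι i →₀ MvPolynomial σ K))
    (hf : ∀ x, f x ∈ LinearMap.range (F.d i)) :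
    ∃ h : (ι →₀ MvPolynomial σ K) →ₗ[MvPolynomial σ K] (F.ι (i + 1) →₀ MvPolynomial σ K),
      ∀ x, F.d i (h x) = f x := by
  choose y hy using fun v => hf (Finsupp.single v 1)
  refine ⟨Finsupp.linearCombination _ y, fun x => ?_⟩
  have : F.d i ∘ₗ Finsupp.linearCombination _ y = f := by
    refine Finsupp.lhom_ext' fun v => LinearMap.ext_ring ?_
    simp [hy]
  exact LinearMap.congr_fun this x

/-- A chain endomorphism of a minimal resolution that lifts zero vanishes modulo the variables. -/
theorem constantCoeff_lift_zero (F : GradedRes K σ I)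
    (χ : ∀ i, (F.ι i →₀ MvPolynomial σ K) →ₗ[MvPolynomial σ K] (F.ι i →₀ MvPolynomial σ K))
    (hε : ∀ x, F.ε (χ 0 x) ∈ I) (hd : ∀ i x, F.d i (χ (i + 1) x) = χ i (F.d i x))
    (i : ℕ) (x : F.ι i →₀ MvPolynomial σ K) (w : F.ι i) :
    constantCoeff (χ i x w) = 0 := by
  have key : ∀ i, (∀ x w, constantCoeff (χ i x w) = 0) ∧
      ∃ h : (F.ι i →₀ MvPolynomial σ K) →ₗ[MvPolynomial σ K]
        (F.ι (i + 1) →₀ MvPolynomial σ K), ∀ x, χ i (F.d i x) = F.d i (h (F.d i x)) := by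
    intro i
    induction i with
    | zero =>
      obtain ⟨h, hh⟩ := F.exists_factor 0 (χ 0) fun x => (F.exact_zero _).mp (hε x)
      exact ⟨fun x w => by rw [← hh, constantCoeff_d], h, fun x => (hh _).symm⟩
    | succ i ih =>
      obtain ⟨-, h, hh⟩ := ih
      obtain ⟨h', hh'⟩ := F.exists_factor (i + 1) (χ (i + 1) - h ∘ₗ F.d i) fun x => by
        rw [← F.exact]
        simp [hd, hh]
      have e : ∀ x, χ (i + 1) x = h (F.d i x) + F.d (i + 1) (h' x) := fun x => by simp [hh']
      refine ⟨fun x w => ?_, h', fun x => by rw [e, F.d_comp_d, map_zero, zero_add]⟩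
      rw [e, Finsupp.add_apply, map_add, constantCoeff_d,
        constantCoeff_map _ _ (F.constantCoeff_d i x), add_zero]
  exact (key i).1 x w

/-- The graded Betti numbers of a resolution. -/
noncomputable def betti (F : GradedRes K σ I) (i j : ℕ) : ℕ :=
  Nat.card { v : F.ι i // F.deg i v = j }

/-- Every graded piece of the basis is finite. -/
def FiniteType (F : GradedRes K σ I) : Prop :=
  ∀ i j, Finite { v : F.ι i // F.deg i v = j }

theorem betti_le (F G : GradedRes K σ I) (hF : F.FiniteType) (hG : G.FiniteType) (i j : ℕ) :
    F.betti i j ≤ G.betti i j := by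
  obtain ⟨φ, hφ, hφε, hφd⟩ := G.exists_lift F (degEq_one 0) (by simp)
  obtain ⟨ψ, hψ, hψε, hψd⟩ := F.exists_lift G (degEq_one 0) (by simp)
  have hχ := F.constantCoeff_lift_zero (fun i => ψ i ∘ₗ φ i - LinearMap.id) (fun x => by
      have h1 := hψε (φ 0 x)
      have h2 := hφε x
      simpa using I.add_mem h1 h2) (fun i x => by simp [hφd, hψd]) i
  have := hF i j
  have := hG i j
  let a : { v : F.ι i // F.deg i v = j } → ({ w : G.ι i // G.deg i w = j } →₀ K) := fun v =>
    ((φ i (Finsupp.single v.1 1)).mapRange constantCoeff (map_zero _)).subtypeDomain _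
  let b : ({ w : G.ι i // G.deg i w = j } →₀ K) →ₗ[K] (F.ι i →₀ K) :=
    Finsupp.linearCombination K fun w =>
      (ψ i (Finsupp.single w.1 1)).mapRange constantCoeff (map_zero _)
  have hba : ∀ v, b (a v) = Finsupp.single v.1 1 := by
    classical
    intro v
    ext u
    have h := hχ (Finsupp.single v.1 1) u
    simp only [LinearMap.sub_apply, LinearMap.comp_apply, LinearMap.id_apply,
      Finsupp.sub_apply, map_sub, sub_eq_zero] at h
    have h1 : constantCoeff ((Finsupp.single v.1 (1 : MvPolynomial σ K)) u) =
        (Finsupp.single v.1 (1 : K)) u := by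
      rw [Finsupp.single_apply, Finsupp.single_apply]
      split_ifs <;> simp
    rw [← h1, ← h, map_eq_sum_single, Finsupp.finsetSum_apply, map_sum]
    simp only [b, a, Finsupp.linearCombination_apply, Finsupp.sum, Finsupp.finsetSum_apply]
    simp only [Finsupp.smul_apply, smul_eq_mul, map_mul, Finsupp.mapRange_apply,
      Finsupp.subtypeDomain_apply]
    refine Finset.sum_bij_ne_zero (fun w _ _ => w.1) ?_ ?_ ?_ ?_
    · intro w hw _
      rw [Finsupp.mem_support_iff] at hw ⊢
      intro h0
      simp [h0] at hw
    · intro w _ _ w' _ _ e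
      exact Subtype.ext e
    · intro w _ hne
      have hdeg : G.deg i w = j := by
        by_contra hcon
        have := (hφ i v.1 w).constantCoeff_eq_zero (by rw [v.2]; simpa using hcon)
        rw [this, zero_mul] at hne
        exact hne rfl
      refine ⟨⟨w, hdeg⟩, ?_, hne, rfl⟩
      rw [Finsupp.mem_support_iff]
      exact left_ne_zero_of_mul hne
    · intro w _ _
      rfl
  have hli : LinearIndependent K a := by
    refine LinearIndependent.of_comp b ?_
    have : b ∘ a = (fun u => Finsupp.single u (1 : K)) ∘ Subtype.val := funext hba
    rw [this]
    exact (Finsupp.basisSingleOne (R := K) (ι := F.ι i)).linearIndependent.comp _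
      Subtype.val_injective |> fun h => by simpa [Function.comp_def] using h
  have := Fintype.ofFinite { v : F.ι i // F.deg i v = j }
  have := Fintype.ofFinite { w : G.ι i // G.deg i w = j }
  have hle := hli.fintype_card_le_finrank
  rwa [Module.finrank_finsupp_self, ← Nat.card_eq_fintype_card, ← Nat.card_eq_fintype_card] at hle

theorem betti_unique (F G : GradedRes K σ I) (hF : F.FiniteType) (hG : G.FiniteType) (i j : ℕ) :
    F.betti i j = G.betti i j :=
  (F.betti_le G hF hG i j).antisymm (G.betti_le F hG hF i j)

/-- The resolution of the polynomial ring itself. -/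
noncomputable def ofBot : GradedRes K σ (⊥ : Ideal (MvPolynomial σ K)) where
  ι i := match i with
    | 0 => Unit
    | _ + 1 => Empty
  deg _ _ := 0
  d _ := 0
  ε := Finsupp.lapply ()
  one := by
    refine ⟨Finsupp.single () 1, fun w => ?_, by simp⟩
    have : w = () := rfl
    subst this
    simpa using degEq_one 0
  exact_zero x := by
    simp only [Ideal.mem_bot, Finsupp.lapply_apply, LinearMap.range_zero, Submodule.mem_bot]
    exact ⟨fun h => Finsupp.ext fun _ => h, fun h => by simp [h]⟩
  exact i x := by
    have : x = 0 := Finsupp.ext fun v => Empty.elim v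
    simp [this]
  graded_aug v := by
    simpa using degEq_one 0
  graded i v := Empty.elim v
  minimal i v := Empty.elim v

section Cone

variable {I I' : Ideal (MvPolynomial σ K)}

/-- The index types of the mapping cone of a map of resolutions `G → F`. -/
abbrev ConeIndex (F : GradedRes K σ I) (G : GradedRes K σ I') : ℕ → Type
  | 0 => F.ι 0
  | i + 1 => F.ι (i + 1) ⊕ G.ι i

/-- The degrees of the basis of the mapping cone of a map of degree `s`. -/
abbrev coneDeg (F : GradedRes K σ I) (G : GradedRes K σ I') (s : ℕ) :
    ∀ i, ConeIndex F G i → ℕ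
  | 0 => F.deg 0
  | i + 1 => Sum.elim (F.deg (i + 1)) fun v => G.deg i v + s

/-- The splitting of a positive term of the mapping cone. -/
noncomputable def coneEquiv (F : GradedRes K σ I) (G : GradedRes K σ I') (i : ℕ) :
    (ConeIndex F G (i + 1) →₀ MvPolynomial σ K) ≃ₗ[MvPolynomial σ K]
      (F.ι (i + 1) →₀ MvPolynomial σ K) × (G.ι i →₀ MvPolynomial σ K) :=
  Finsupp.sumFinsuppLEquivProdFinsupp _

/-- The differential of the mapping cone. -/
noncomputable def coneD (F : GradedRes K σ I) (G : GradedRes K σ I')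
    (φ : ∀ i, (G.ι i →₀ MvPolynomial σ K) →ₗ[MvPolynomial σ K] (F.ι i →₀ MvPolynomial σ K)) :
    ∀ i, (ConeIndex F G (i + 1) →₀ MvPolynomial σ K) →ₗ[MvPolynomial σ K]
      (ConeIndex F G i →₀ MvPolynomial σ K)
  | 0 => (F.d 0).coprod (φ 0) ∘ₗ (coneEquiv F G 0).toLinearMap
  | i + 1 => (coneEquiv F G i).symm.toLinearMap ∘ₗ
      ((F.d (i + 1)).coprod (φ (i + 1))).prod (-(G.d i ∘ₗ LinearMap.snd _ _ _)) ∘ₗ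
      (coneEquiv F G (i + 1)).toLinearMap

lemma coneD_zero_symm (F : GradedRes K σ I) (G : GradedRes K σ I') (φ) (f g) :
    coneD F G φ 0 ((coneEquiv F G 0).symm (f, g)) = F.d 0 f + φ 0 g := by
  simp [coneD]

lemma coneD_succ_symm (F : GradedRes K σ I) (G : GradedRes K σ I') (φ) (i : ℕ) (f g) :
    coneD F G φ (i + 1) ((coneEquiv F G (i + 1)).symm (f, g)) =
      (coneEquiv F G i).symm (F.d (i + 1) f + φ (i + 1) g, -G.d i g) := by
  simp [coneD]

lemma coneEquiv_symm_inl (F : GradedRes K σ I) (G : GradedRes K σ I') (i : ℕ) (f g) (v) :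
    (coneEquiv F G i).symm (f, g) (Sum.inl v : F.ι (i + 1) ⊕ G.ι i) = f v :=
  Finsupp.sumFinsuppLEquivProdFinsupp_symm_inl _ (f, g) v

lemma coneEquiv_symm_inr (F : GradedRes K σ I) (G : GradedRes K σ I') (i : ℕ) (f g) (v) :
    (coneEquiv F G i).symm (f, g) (Sum.inr v : F.ι (i + 1) ⊕ G.ι i) = g v :=
  Finsupp.sumFinsuppLEquivProdFinsupp_symm_inr _ (f, g) v

lemma single_inl (F : GradedRes K σ I) (G : GradedRes K σ I') (i : ℕ) (v : F.ι (i + 1)) :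
    (Finsupp.single (Sum.inl v : F.ι (i + 1) ⊕ G.ι i) 1 : _ →₀ MvPolynomial σ K) =
      (coneEquiv F G i).symm (Finsupp.single v 1, 0) := by
  classical
  ext1 (w | w)
  · rw [coneEquiv_symm_inl]
    simp [Finsupp.single_apply]
  · rw [coneEquiv_symm_inr]
    simp

lemma single_inr (F : GradedRes K σ I) (G : GradedRes K σ I') (i : ℕ) (v : G.ι i) :
    (Finsupp.single (Sum.inr v : F.ι (i + 1) ⊕ G.ι i) 1 : _ →₀ MvPolynomial σ K) =
      (coneEquiv F G i).symm (0, Finsupp.single v 1) := by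
  classical
  ext1 (w | w)
  · rw [coneEquiv_symm_inl]
    simp
  · rw [coneEquiv_symm_inr]
    simp [Finsupp.single_apply]

lemma coneEquiv_surj (F : GradedRes K σ I) (G : GradedRes K σ I') (i : ℕ)
    (x : ConeIndex F G (i + 1) →₀ MvPolynomial σ K) :
    ∃ f g, x = (coneEquiv F G i).symm (f, g) :=
  ⟨(coneEquiv F G i x).1, (coneEquiv F G i x).2, by simp⟩

/-- The mapping cone of a lift of multiplication by `r`, as a resolution of the quotient by
`I + (r)`, when `I'` is the colon ideal of `r`. -/
noncomputable def cone (F : GradedRes K σ I) (G : GradedRes K σ I') {r : MvPolynomial σ K} {s : ℕ}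
    (hI : ∀ a, a ∈ I' ↔ r * a ∈ I)
    (φ : ∀ i, (G.ι i →₀ MvPolynomial σ K) →ₗ[MvPolynomial σ K] (F.ι i →₀ MvPolynomial σ K))
    (hφ : ∀ i v, HomEl (F.deg i) (G.deg i v + s) (φ i (Finsupp.single v 1)))
    (hφε : ∀ x, F.ε (φ 0 x) - r * G.ε x ∈ I)
    (hφd : ∀ i x, F.d i (φ (i + 1) x) = φ i (G.d i x))
    (hmin : ∀ i v w, F.deg i w ≠ G.deg i v + s) :
    GradedRes K σ (I ⊔ Ideal.span {r}) where
  ι := ConeIndex F G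
  deg := coneDeg F G s
  d := coneD F G φ
  ε := F.ε
  one := by
    obtain ⟨y, hy, h1⟩ := F.one
    exact ⟨y, hy, Ideal.mem_sup_left h1⟩
  exact_zero x := by
    constructor
    · intro hx
      obtain ⟨a, ha, b, hb, hab⟩ := Submodule.mem_sup.mp hx
      obtain ⟨c, rfl⟩ := Ideal.mem_span_singleton'.mp hb
      obtain ⟨y, -, hy⟩ := G.one
      have h1 := (hI _).mp (I'.mul_mem_left c hy)
      have h2 := hφε (c • y)
      have : F.ε (x - φ 0 (c • y)) ∈ I := by
        have e : F.ε (x - φ 0 (c • y)) =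
            a - r * (c * (G.ε y - 1)) - (F.ε (φ 0 (c • y)) - r * G.ε (c • y)) := by
          rw [map_sub, ← hab, map_smul G.ε, smul_eq_mul]
          ring
        rw [e]
        exact I.sub_mem (I.sub_mem ha h1) h2
      obtain ⟨f, hf⟩ := (F.exact_zero _).mp this
      refine ⟨(coneEquiv F G 0).symm (f, c • y), ?_⟩
      rw [coneD_zero_symm, hf, sub_add_cancel]
    · rintro ⟨x, rfl⟩
      obtain ⟨f, g, rfl⟩ := coneEquiv_surj F G 0 x
      rw [coneD_zero_symm, map_add]
      refine add_mem (Ideal.mem_sup_left ((F.exact_zero _).mpr ⟨f, rfl⟩)) ?_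
      rw [← sub_add_cancel (F.ε (φ 0 g)) (r * G.ε g)]
      exact add_mem (Ideal.mem_sup_left (hφε g))
        (Ideal.mem_sup_right (Ideal.mul_mem_right _ _ (Ideal.mem_span_singleton_self r)))
  exact i x := by
    obtain ⟨f, g, rfl⟩ := coneEquiv_surj F G i x
    have main : (∃ g', G.d i g' = g) → F.d i f + φ i g = 0 →
        (coneEquiv F G i).symm (f, g) ∈ LinearMap.range (coneD F G φ (i + 1)) := by
      rintro ⟨g', rfl⟩ h
      rw [← hφd, ← map_add] at h
      obtain ⟨f', hf'⟩ := (F.exact i _).mp h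
      refine ⟨(coneEquiv F G (i + 1)).symm (f', -g'), ?_⟩
      rw [coneD_succ_symm, hf']
      simp
    have conv : (coneEquiv F G i).symm (f, g) ∈ LinearMap.range (coneD F G φ (i + 1)) →
        F.d i f + φ i g = 0 ∧ ∃ g', G.d i g' = g := by
      rintro ⟨y, hy⟩
      obtain ⟨f', g', rfl⟩ := coneEquiv_surj F G (i + 1) y
      rw [coneD_succ_symm] at hy
      have := (coneEquiv F G i).symm.injective hy
      simp only [Prod.mk.injEq] at this
      obtain ⟨rfl, rfl⟩ := this
      refine ⟨?_, -g', by simp⟩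
      simp [hφd, F.d_comp_d]
    cases i with
    | zero =>
      rw [coneD_zero_symm]
      refine ⟨fun h => main ?_ h, fun h => (conv h).1⟩
      have h1 : F.ε (φ 0 g) ∈ I := by
        rw [eq_neg_of_add_eq_zero_right h, map_neg]
        exact I.neg_mem ((F.exact_zero _).mpr ⟨f, rfl⟩)
      have h2 : r * G.ε g ∈ I := by simpa using I.sub_mem h1 (hφε g)
      exact (G.exact_zero g).mp ((hI _).mpr h2)
    | succ i =>
      rw [coneD_succ_symm, LinearEquiv.map_eq_zero_iff, Prod.mk_eq_zero, neg_eq_zero]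
      refine ⟨fun h => main ((G.exact i g).mp h.2) h.1, fun h => ?_⟩
      obtain ⟨h1, h2⟩ := conv h
      exact ⟨h1, (G.exact i g).mpr h2⟩
  graded_aug := F.graded_aug
  graded i v := by
    rcases v with v | v
    · rw [single_inl]
      cases i with
      | zero =>
        rw [coneD_zero_symm, map_zero, add_zero]
        exact F.graded 0 v
      | succ i =>
        rw [coneD_succ_symm]
        rintro (w | w)
        · rw [coneEquiv_symm_inl, map_zero, add_zero]
          exact F.graded (i + 1) v w
        · rw [coneEquiv_symm_inr, map_zero, neg_zero]
          exact DegEq.zero _ _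
    · rw [single_inr]
      cases i with
      | zero =>
        rw [coneD_zero_symm, map_zero, zero_add (φ 0 _)]
        exact hφ 0 v
      | succ i =>
        rw [coneD_succ_symm]
        rintro (w | w)
        · rw [coneEquiv_symm_inl, map_zero, zero_add]
          exact hφ (i + 1) v w
        · rw [coneEquiv_symm_inr]
          exact ((G.graded i v w).shift s).neg
  minimal i v w := by
    rcases v with v | v
    · rw [single_inl]
      cases i with
      | zero =>
        rw [coneD_zero_symm, map_zero, add_zero]
        exact F.minimal 0 v w
      | succ i =>
        rw [coneD_succ_symm]
        rcases w with w | w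
        · rw [coneEquiv_symm_inl, map_zero, add_zero]
          exact F.minimal (i + 1) v w
        · rw [coneEquiv_symm_inr, map_zero, neg_zero, Finsupp.zero_apply, map_zero]
    · rw [single_inr]
      cases i with
      | zero =>
        rw [coneD_zero_symm, map_zero, zero_add]
        exact (hφ 0 v w).constantCoeff_eq_zero (hmin 0 v w)
      | succ i =>
        rw [coneD_succ_symm]
        rcases w with w | w
        · rw [coneEquiv_symm_inl, map_zero, zero_add]
          exact (hφ (i + 1) v w).constantCoeff_eq_zero (hmin (i + 1) v w)
        · rw [coneEquiv_symm_inr, Finsupp.neg_apply, map_neg, G.minimal, neg_zero]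

end Cone

end GradedRes

variable (K σ) in
/-- The quotient by `I` has a minimal graded free resolution with graded Betti numbers `p`. -/
def HasBetti (I : Ideal (MvPolynomial σ K)) (p : ℕ → ℕ → ℕ) : Prop :=
  ∃ F : GradedRes K σ I, F.FiniteType ∧ ∀ i j, F.betti i j = p i j

/-- The graded Betti numbers of the mapping cone of a map of degree `s`. -/
def coneBetti (p q : ℕ → ℕ → ℕ) (s : ℕ) : ℕ → ℕ → ℕ
  | 0, j => p 0 j
  | i + 1, j => p (i + 1) j + if s ≤ j then q i (j - s) else 0

lemma hasBetti_bot : HasBetti K σ ⊥ fun i j => if i = 0 ∧ j = 0 then 1 else 0 := by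
  have h0 : ∀ i, Finite ((GradedRes.ofBot (K := K) (σ := σ)).ι i)
    | 0 => inferInstanceAs (Finite Unit)
    | _ + 1 => inferInstanceAs (Finite Empty)
  refine ⟨GradedRes.ofBot, fun i j => ?_, fun i j => ?_⟩
  · have := h0 i
    infer_instance
  · match i with
    | 0 =>
      change Nat.card { v : Unit // 0 = j } = _
      rcases eq_or_ne j 0 with rfl | hj
      · simp
      · have : IsEmpty { v : Unit // 0 = j } := ⟨fun v => hj v.2.symm⟩
        simp [hj]
    | i + 1 =>
      change Nat.card { v : Empty // 0 = j } = _
      simp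

/-- Adding to an ideal a generator of high degree whose colon ideal has a linear resolution. -/
theorem HasBetti.cone {I I' : Ideal (MvPolynomial σ K)} {p q : ℕ → ℕ → ℕ}
    (hp : HasBetti K σ I p) (hq : HasBetti K σ I' q) {r : MvPolynomial σ K} {s : ℕ}
    (hr : DegEq r 0 s) (hI : ∀ a, a ∈ I' ↔ r * a ∈ I)
    (hps : ∀ i j, p i j ≠ 0 → j < i + s) (hqs : ∀ i j, q i j ≠ 0 → j = i) :
    HasBetti K σ (I ⊔ Ideal.span {r}) (coneBetti p q s) := by
  obtain ⟨F, hF, hFp⟩ := hp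
  obtain ⟨G, hG, hGq⟩ := hq
  have degF : ∀ i w, F.deg i w < i + s := fun i w => by
    refine hps i _ ?_
    have := hF i (F.deg i w)
    rw [← hFp]
    exact Nat.card_ne_zero.mpr ⟨⟨⟨w, rfl⟩⟩, this⟩
  have degG : ∀ i w, G.deg i w = i := fun i w => by
    refine hqs i _ ?_
    have := hG i (G.deg i w)
    rw [← hGq]
    exact Nat.card_ne_zero.mpr ⟨⟨⟨w, rfl⟩⟩, this⟩
  obtain ⟨φ, hφ, hφε, hφd⟩ := F.exists_lift G hr fun a ha => (hI a).mp ha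
  have e : ∀ i j, { v // GradedRes.coneDeg F G s (i + 1) v = j } ≃
      { v // F.deg (i + 1) v = j } ⊕ { v : G.ι i // G.deg i v + s = j } := fun i j =>
    Equiv.subtypeSum (α := F.ι (i + 1)) (β := G.ι i)
  have hfin : ∀ i j, Finite { v : G.ι i // G.deg i v + s = j } := fun i j => by
    have := hG i (j - s)
    refine Finite.of_injective (β := { v : G.ι i // G.deg i v = j - s })
      (fun v => ⟨v.1, by have := v.2; omega⟩) fun v w h => ?_
    simpa [Subtype.ext_iff] using h
  refine ⟨GradedRes.cone F G hI φ hφ hφε hφd fun i v w => ?_, fun i j => ?_, fun i j => ?_⟩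
  · have := degF i w
    rw [degG]
    omega
  · cases i with
    | zero => exact hF 0 j
    | succ i =>
      have := hF (i + 1) j
      have := hfin i j
      exact Finite.of_equiv _ (e i j).symm
  · cases i with
    | zero => exact hFp 0 j
    | succ i =>
      have := hF (i + 1) j
      have := hfin i j
      refine (Nat.card_congr (e i j)).trans ?_
      rw [Nat.card_sum, coneBetti, ← hFp, ← hGq]
      congr 1
      split_ifs with h
      · exact Nat.card_congr (Equiv.subtypeEquivRight fun v => by omega)
      · have : IsEmpty { v : G.ι i // G.deg i v + s = j } := ⟨fun v => by have := v.2; omega⟩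
        simp

lemma HasBetti.congr {I : Ideal (MvPolynomial σ K)} {p q : ℕ → ℕ → ℕ} (hp : HasBetti K σ I p)
    (h : ∀ i j, p i j = q i j) : HasBetti K σ I q := by
  obtain ⟨F, hF, hFp⟩ := hp
  exact ⟨F, hF, fun i j => (hFp i j).trans (h i j)⟩

/-- The graded Betti numbers of an ideal of variables. -/
theorem hasBetti_span_X (A : Finset σ) :
    HasBetti K σ (Ideal.span (X '' (A : Set σ))) fun i j =>
      if j = i then A.card.choose i else 0 := by
  classical
  induction A using Finset.induction_on with
  | empty =>
    simp only [Finset.coe_empty, Set.image_empty, Ideal.span_empty, Finset.card_empty]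
    refine hasBetti_bot.congr fun i j => ?_
    rcases i with _ | i
    · simp
    · simp
  | insert e A he ih =>
    have hI : ∀ a : MvPolynomial σ K, a ∈ Ideal.span (X '' (A : Set σ)) ↔
        X e * a ∈ Ideal.span (X '' (A : Set σ)) := by
      intro a
      refine ⟨fun h => Ideal.mul_mem_left _ _ h, fun h => ?_⟩
      rw [mem_ideal_span_X_image] at h ⊢
      intro m hm
      obtain ⟨i, hi, hne⟩ := h (Finsupp.single e 1 + m) (by
        rw [mem_support_iff] at hm ⊢
        rwa [coeff_X_mul])
      refine ⟨i, hi, ?_⟩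
      have : e ≠ i := fun h => he (h ▸ hi)
      simpa [Finsupp.single_apply, this] using hne
    have hX : DegEq (X e : MvPolynomial σ K) 0 1 := by
      intro m hm
      rw [coeff_X] at hm
      have : Finsupp.single e 1 = m := by
        by_contra h
        simp [h] at hm
      simp [← this]
    have := ih.cone ih hX hI (fun i j h => by
      have : j = i := by
        by_contra hne
        simp [hne] at h
      omega) (fun i j h => by
      by_contra hne
      simp [hne] at h)
    rw [Finset.coe_insert, Set.image_insert_eq, Ideal.span_insert, sup_comm]
    refine this.congr fun i j => ?_
    rw [Finset.card_insert_of_notMem he]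
    rcases i with _ | i
    · simp [coneBetti]
    · rw [coneBetti]
      split_ifs <;> first | omega | simp [Nat.choose_succ_succ, add_comm]

/-- The exponent of a squarefree monomial. -/
noncomputable def sqExp (C : Finset σ) : σ →₀ ℕ := ∑ e ∈ C, Finsupp.single e 1

lemma sqExp_apply [DecidableEq σ] (C : Finset σ) (e : σ) :
    sqExp C e = if e ∈ C then 1 else 0 := by
  simp [sqExp, Finsupp.finsetSum_apply, Finsupp.single_apply]

lemma monomial_sqExp (C : Finset σ) :
    monomial (sqExp C) (1 : K) = ∏ e ∈ C, X e := by
  rw [sqExp, monomial_sum_one]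
  rfl

variable (K) in
/-- The ideal generated by the squarefree monomials of a family of sets. -/
noncomputable def sqIdeal {τ : Type} (C : τ → Finset σ) (s : Set τ) : Ideal (MvPolynomial σ K) :=
  Ideal.span ((fun t => ∏ e ∈ C t, X e) '' s)

lemma mem_sqIdeal {τ : Type} {C : τ → Finset σ} {s : Set τ} {p : MvPolynomial σ K} :
    p ∈ sqIdeal K C s ↔ ∀ m ∈ p.support, ∃ t ∈ s, sqExp (C t) ≤ m := by
  have : (fun t => ∏ e ∈ C t, (X e : MvPolynomial σ K)) '' s =
      (fun m => monomial m 1) '' ((fun t => sqExp (C t)) '' s) := by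
    rw [Set.image_image]
    simp only [monomial_sqExp]
  rw [sqIdeal, this, mem_ideal_span_monomial_image]
  simp

/-- The graded Betti numbers of a squarefree monomial ideal with linear quotients. -/
theorem hasBetti_linear_quotients {τ : Type} (C A : τ → Finset σ) (s : Finset τ)
    (hpos : ∀ t ∈ s, 1 ≤ (C t).card)
    (hdisj : ∀ t ∈ s, Disjoint (A t) (C t))
    (hmeet : ∀ t ∈ s, ∀ t' ∈ s, t' ≠ t → (C t').card ≤ (C t).card → ∃ e ∈ C t', e ∈ A t)
    (hrepl : ∀ t ∈ s, ∀ e ∈ A t, ∃ t' ∈ s, (C t').card < (C t).card ∧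
      ∀ x ∈ C t', x = e ∨ x ∈ C t) :
    ∃ p, HasBetti K σ (sqIdeal K C s) p ∧ ∀ i j, p (i + 1) j =
      ∑ t ∈ s, if j = i + (C t).card then (A t).card.choose i else 0 := by
  classical
  suffices h : HasBetti K σ (sqIdeal K C s) fun i j => match i with
      | 0 => if j = 0 then 1 else 0
      | i + 1 => ∑ t ∈ s, if j = i + (C t).card then (A t).card.choose i else 0 from
    ⟨_, h, fun _ _ => rfl⟩
  induction s using Finset.induction_on_max_value (fun t => (C t).card) with
  | empty =>
    have : sqIdeal K C (∅ : Finset τ) = (⊥ : Ideal (MvPolynomial σ K)) := by simp [sqIdeal]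
    rw [this]
    refine hasBetti_bot.congr fun i j => ?_
    rcases i with _ | i <;> simp
  | insert a s ha hmax ih =>
    have ih := ih (fun t ht => hpos t (Finset.mem_insert_of_mem ht))
      (fun t ht => hdisj t (Finset.mem_insert_of_mem ht))
      (fun t ht t' ht' => hmeet t (Finset.mem_insert_of_mem ht) t' (Finset.mem_insert_of_mem ht'))
      (fun t ht e he => by
        obtain ⟨t', ht', hlt, h⟩ := hrepl t (Finset.mem_insert_of_mem ht) e he
        refine ⟨t', ?_, hlt, h⟩
        rcases Finset.mem_insert.mp ht' with rfl | h'
        · exact absurd hlt (not_lt.mpr (hmax t ht))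
        · exact h')
    have hA := hasBetti_span_X (K := K) (A a)
    have haa := Finset.mem_insert_self a s
    have hI : ∀ b : MvPolynomial σ K, b ∈ Ideal.span (X '' (A a : Set σ)) ↔
        (∏ e ∈ C a, X e) * b ∈ sqIdeal K C (s : Set τ) := by
      intro b
      rw [mem_ideal_span_X_image, mem_sqIdeal, ← monomial_sqExp]
      constructor
      · intro h m hm
        rw [mem_support_iff, coeff_monomial_mul'] at hm
        have hle : sqExp (C a) ≤ m := by
          by_contra hcon
          simp [hcon] at hm
        rw [if_pos hle, one_mul] at hm
        obtain ⟨e, he, hne⟩ := h _ (mem_support_iff.mpr hm)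
        obtain ⟨t', ht', hlt, ht'C⟩ := hrepl a haa e he
        refine ⟨t', ?_, fun x => ?_⟩
        · rcases Finset.mem_insert.mp ht' with rfl | h'
          · exact absurd hlt (lt_irrefl _)
          · exact h'
        · rw [sqExp_apply]
          split_ifs with hx
          · rcases ht'C x hx with rfl | hxa
            · rw [Finsupp.tsub_apply] at hne
              omega
            · have := hle x
              rwa [sqExp_apply, if_pos hxa] at this
          · exact Nat.zero_le _
      · intro h m hm
        obtain ⟨t, ht, hle⟩ := h (sqExp (C a) + m) (by
          rw [mem_support_iff] at hm ⊢
          rwa [coeff_monomial_mul, one_mul])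
        have hta : t ≠ a := fun h => ha (h ▸ ht)
        obtain ⟨e, he, heA⟩ := hmeet a haa t (Finset.mem_insert_of_mem ht) hta (hmax t ht)
        refine ⟨e, heA, ?_⟩
        have h1 := hle e
        have h2 : e ∉ C a := Finset.disjoint_left.mp (hdisj a haa) heA
        rw [Finsupp.add_apply, sqExp_apply, sqExp_apply, if_pos he, if_neg h2] at h1
        omega
    have hdeg : DegEq (∏ e ∈ C a, (X e : MvPolynomial σ K)) 0 (C a).card := by
      rw [← monomial_sqExp]
      intro m hm
      rw [coeff_monomial] at hm
      have : sqExp (C a) = m := by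
        by_contra h
        simp [h] at hm
      rw [← this, sqExp, map_sum]
      simp
    have := ih.cone hA hdeg hI (fun i j h => by
      rcases i with _ | i
      · have := hpos a haa
        have : j = 0 := by
          by_contra hne
          simp [hne] at h
        omega
      · obtain ⟨t, ht, hne⟩ := Finset.exists_ne_zero_of_sum_ne_zero h
        have h1 := hmax t ht
        have : j = i + (C t).card := by
          by_contra hne'
          simp [hne'] at hne
        omega) (fun i j h => by
      by_contra hne
      simp [hne] at h)
    have e : sqIdeal K C (insert a s : Finset τ) =
        sqIdeal K C s ⊔ Ideal.span {∏ e ∈ C a, (X e : MvPolynomial σ K)} := by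
      rw [sqIdeal, Finset.coe_insert, Set.image_insert_eq, Ideal.span_insert, sup_comm]
      rfl
    rw [e]
    refine this.congr fun i j => ?_
    rcases i with _ | i
    · rfl
    · simp only [coneBetti, Finset.sum_insert ha]
      rw [add_comm]
      congr 1
      split_ifs <;> omega

lemma DegEq.of_isHomogeneous {p : MvPolynomial σ K} {c n : ℕ} (hc : c ≤ n)
    (hp : p.IsHomogeneous (n - c)) : DegEq p c n := by
  intro m hm
  have := hp hm
  have h1 : Finsupp.degree m = Finsupp.weight (1 : σ → ℕ) m :=
    DFunLike.congr_fun Finsupp.degree_eq_weight_one m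
  omega

/-- The Betti numbers of a minimal graded free resolution of a squarefree monomial ideal. -/
theorem MinGradedFreeRes.betti_eq {τ : Type} {C : τ → Finset σ} {s : Set τ} {b p : ℕ → ℕ → ℕ}
    (R : MinGradedFreeRes K σ (sqIdeal K C s) b) (hp : HasBetti K σ (sqIdeal K C s) p) (i j : ℕ) :
    b i j = p i j := by
  choose g hg hgaug using R.graded_aug
  let ε := Finsupp.linearCombination (MvPolynomial σ K) g
  have hε : ∀ x, Ideal.Quotient.mk _ (ε x) = R.aug x := by
    intro x
    have : (Submodule.mkQ (sqIdeal K C s)) ∘ₗ ε = R.aug := by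
      refine Finsupp.lhom_ext' fun v => LinearMap.ext_ring ?_
      simp only [LinearMap.comp_apply, Finsupp.lsingle_apply, hgaug, ε,
        Finsupp.linearCombination_single, one_smul]
      rfl
    exact LinearMap.congr_fun this x
  have hgε : ∀ v, DegEq (ε (Finsupp.single v 1)) 0 v.1 := fun v => by
    simpa [ε] using DegEq.of_isHomogeneous (Nat.zero_le _) (hg v)
  have hpart : ∀ a ∈ sqIdeal K C s, shiftPart 0 0 a ∈ sqIdeal K C s := by
    intro a ha
    rw [mem_sqIdeal] at ha ⊢
    intro m hm
    rw [mem_support_iff, coeff_shiftPart] at hm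
    refine ha m (mem_support_iff.mpr fun h => ?_)
    simp [h] at hm
  let F : GradedRes K σ (sqIdeal K C s) :=
    { ι := fun i => Σ j : ℕ, Fin (b i j)
      deg := fun _ v => v.1
      d := R.d
      ε := ε
      one := by
        obtain ⟨y, hy⟩ := R.aug_surjective (Ideal.Quotient.mk _ 1)
        rw [← hε, Ideal.Quotient.eq] at hy
        refine ⟨gradedPart (fun v => v.1) 0 y, homEl_gradedPart _ _ _, ?_⟩
        have := hpart _ hy
        rw [map_sub, shiftPart_of_degEq (degEq_one 0)] at this
        rwa [map_gradedPart hgε]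
      exact_zero := fun x => by
        rw [← R.exact_zero, LinearMap.mem_ker, ← hε, Ideal.Quotient.eq_zero_iff_mem]
      exact := fun i x => by
        rw [← R.exact, LinearMap.mem_ker]
      graded_aug := hgε
      graded := fun i v w => by
        by_cases h : (R.d i (Finsupp.single v 1)) w = 0
        · rw [h]
          exact DegEq.zero _ _
        · obtain ⟨h1, h2⟩ := R.graded i v w h
          exact DegEq.of_isHomogeneous h1 h2
      minimal := R.minimal }
  obtain ⟨G, hG, hGp⟩ := hp
  have e : ∀ i j, { v : F.ι i // F.deg i v = j } ≃ Fin (b i j) := fun i j =>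
    Equiv.sigmaSubtype j
  have hF : F.FiniteType := fun i j => Finite.of_equiv _ (e i j).symm
  rw [← hGp, ← F.betti_unique G hF hG, GradedRes.betti, Nat.card_congr (e i j)]
  simp

end GradedFree

namespace BinaryTree

/-- The root-to-leaf paths of a binary tree. -/
def leafPaths : BinaryTree Unit → Finset (List (Fin 2))
  | nil => {[]}
  | node _ l r => l.leafPaths.image (List.cons 0) ∪ r.leafPaths.image (List.cons 1)

/-- The paths from the root to the internal nodes of a binary tree. -/
def innerPaths : BinaryTree Unit → Finset (List (Fin 2))
  | nil => ∅
  | node _ l r => insert [] (l.innerPaths.image (List.cons 0) ∪ r.innerPaths.image (List.cons 1))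

/-- The trees of height at most `n`. -/
def treesOfHeightLE : ℕ → Finset (BinaryTree Unit)
  | 0 => {nil}
  | n + 1 => insert nil ((treesOfHeightLE n ×ˢ treesOfHeightLE n).image fun x => node () x.1 x.2)

lemma mem_treesOfHeightLE {n : ℕ} {t : BinaryTree Unit} :
    t ∈ treesOfHeightLE n ↔ t.height ≤ n := by
  induction t generalizing n with
  | nil => cases n <;> simp [treesOfHeightLE, height]
  | node v l r hl hr => cases n <;> simp [treesOfHeightLE, height, hl, hr]

lemma nil_notMem_leafPaths {v : Unit} {l r : BinaryTree Unit} : [] ∉ (node v l r).leafPaths := by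
  simp [leafPaths]

lemma nil_mem_leafPaths_iff {t : BinaryTree Unit} : [] ∈ t.leafPaths ↔ t = nil := by
  cases t <;> simp [leafPaths]

lemma cons_zero_mem_leafPaths {v : Unit} {l r : BinaryTree Unit} {p : List (Fin 2)} :
    0 :: p ∈ (node v l r).leafPaths ↔ p ∈ l.leafPaths := by
  simp [leafPaths]

lemma cons_one_mem_leafPaths {v : Unit} {l r : BinaryTree Unit} {p : List (Fin 2)} :
    1 :: p ∈ (node v l r).leafPaths ↔ p ∈ r.leafPaths := by
  simp [leafPaths]

lemma cons_zero_mem_innerPaths {v : Unit} {l r : BinaryTree Unit} {p : List (Fin 2)} :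
    0 :: p ∈ (node v l r).innerPaths ↔ p ∈ l.innerPaths := by
  simp [innerPaths]

lemma cons_one_mem_innerPaths {v : Unit} {l r : BinaryTree Unit} {p : List (Fin 2)} :
    1 :: p ∈ (node v l r).innerPaths ↔ p ∈ r.innerPaths := by
  simp [innerPaths]

lemma nil_mem_innerPaths_iff {t : BinaryTree Unit} : [] ∈ t.innerPaths ↔ t ≠ nil := by
  cases t <;> simp [innerPaths]

lemma disjoint_image_cons (s t : Finset (List (Fin 2))) :
    Disjoint (s.image (List.cons 0)) (t.image (List.cons 1)) := by
  simp [Finset.disjoint_left]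

lemma card_leafPaths (t : BinaryTree Unit) : t.leafPaths.card = t.numNodes + 1 := by
  induction t with
  | nil => rfl
  | node v l r hl hr =>
    rw [leafPaths, Finset.card_union_of_disjoint (disjoint_image_cons _ _),
      Finset.card_image_of_injective _ List.cons_injective,
      Finset.card_image_of_injective _ List.cons_injective, hl, hr, numNodes]
    omega

lemma card_innerPaths (t : BinaryTree Unit) : t.innerPaths.card = t.numNodes := by
  induction t with
  | nil => rfl
  | node v l r hl hr =>
    rw [innerPaths, Finset.card_insert_of_notMem (by simp),
      Finset.card_union_of_disjoint (disjoint_image_cons _ _),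
      Finset.card_image_of_injective _ List.cons_injective,
      Finset.card_image_of_injective _ List.cons_injective, hl, hr, numNodes]

lemma disjoint_innerPaths_leafPaths (t : BinaryTree Unit) :
    Disjoint t.innerPaths t.leafPaths := by
  rw [Finset.disjoint_left]
  induction t with
  | nil => simp [innerPaths]
  | node v l r hl hr =>
    rintro (_ | ⟨a, p⟩) hp
    · exact nil_notMem_leafPaths
    · revert hp
      fin_cases a
      · exact fun hp h => hl (cons_zero_mem_innerPaths.mp hp) (cons_zero_mem_leafPaths.mp h)
      · exact fun hp h => hr (cons_one_mem_innerPaths.mp hp) (cons_one_mem_leafPaths.mp h)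

lemma length_le_of_mem_leafPaths {t : BinaryTree Unit} {p : List (Fin 2)}
    (hp : p ∈ t.leafPaths) : p.length ≤ t.height := by
  induction t generalizing p with
  | nil => simp_all [leafPaths]
  | node v l r hl hr =>
    simp only [leafPaths, Finset.mem_union, Finset.mem_image] at hp
    rcases hp with ⟨q, hq, rfl⟩ | ⟨q, hq, rfl⟩
    · have := hl hq
      simp only [List.length_cons, height]
      omega
    · have := hr hq
      simp only [List.length_cons, height]
      omega

lemma length_le_of_mem_innerPaths {t : BinaryTree Unit} {p : List (Fin 2)}
    (hp : p ∈ t.innerPaths) : p.length ≤ t.height := by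
  induction t generalizing p with
  | nil => simp [innerPaths] at hp
  | node v l r hl hr =>
    simp only [innerPaths, Finset.mem_insert, Finset.mem_union, Finset.mem_image] at hp
    rcases hp with rfl | ⟨q, hq, rfl⟩ | ⟨q, hq, rfl⟩
    · simp
    · have := hl hq
      simp only [List.length_cons, height]
      omega
    · have := hr hq
      simp only [List.length_cons, height]
      omega

lemma exists_mem_leafPaths_mem_innerPaths {t' t : BinaryTree Unit} (hne : t' ≠ t)
    (hle : t'.numNodes ≤ t.numNodes) : ∃ p ∈ t'.leafPaths, p ∈ t.innerPaths := by
  induction t' generalizing t with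
  | nil => exact ⟨[], by simp [leafPaths], nil_mem_innerPaths_iff.mpr hne.symm⟩
  | node v' l' r' hl hr =>
    cases t with
    | nil => simp [numNodes] at hle
    | node v l r =>
      simp only [numNodes] at hle
      by_cases h1 : l' ≠ l ∧ l'.numNodes ≤ l.numNodes
      · obtain ⟨p, hp, hp'⟩ := hl h1.1 h1.2
        exact ⟨0 :: p, cons_zero_mem_leafPaths.mpr hp, cons_zero_mem_innerPaths.mpr hp'⟩
      by_cases h2 : r' ≠ r ∧ r'.numNodes ≤ r.numNodes
      · obtain ⟨p, hp, hp'⟩ := hr h2.1 h2.2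
        exact ⟨1 :: p, cons_one_mem_leafPaths.mpr hp, cons_one_mem_innerPaths.mpr hp'⟩
      exfalso
      by_cases hl' : l' = l
      · subst hl'
        by_cases hr' : r' = r
        · exact hne (by rw [hr'])
        · exact h2 ⟨hr', by omega⟩
      · have h3 : l.numNodes < l'.numNodes := by
          by_contra h
          exact h1 ⟨hl', by omega⟩
        exact h2 ⟨fun h => by subst h; omega, by omega⟩

lemma exists_prune {t : BinaryTree Unit} {p : List (Fin 2)} (hp : p ∈ t.innerPaths) :
    ∃ t', t'.numNodes < t.numNodes ∧ t'.height ≤ t.height ∧ (p ≠ [] → t' ≠ nil) ∧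
      ∀ q ∈ t'.leafPaths, q = p ∨ q ∈ t.leafPaths := by
  induction t generalizing p with
  | nil => simp [innerPaths] at hp
  | node v l r hl hr =>
    simp only [innerPaths, Finset.mem_insert, Finset.mem_union, Finset.mem_image] at hp
    rcases hp with rfl | ⟨p, hp, rfl⟩ | ⟨p, hp, rfl⟩
    · exact ⟨nil, by simp [numNodes], by simp [height], by simp, by simp [leafPaths]⟩
    · obtain ⟨t', h1, h2, -, h4⟩ := hl hp
      refine ⟨node v t' r, by simp only [numNodes]; omega, by simp only [height]; omega,
        by simp, fun q hq => ?_⟩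
      simp only [leafPaths, Finset.mem_union, Finset.mem_image] at hq ⊢
      rcases hq with ⟨q, hq, rfl⟩ | hq
      · rcases h4 q hq with rfl | h
        · exact Or.inl rfl
        · exact Or.inr (Or.inl ⟨q, h, rfl⟩)
      · exact Or.inr (Or.inr hq)
    · obtain ⟨t', h1, h2, -, h4⟩ := hr hp
      refine ⟨node v l t', by simp only [numNodes]; omega, by simp only [height]; omega,
        by simp, fun q hq => ?_⟩
      simp only [leafPaths, Finset.mem_union, Finset.mem_image] at hq ⊢
      rcases hq with hq | ⟨q, hq, rfl⟩
      · exact Or.inr (Or.inl hq)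
      · rcases h4 q hq with rfl | h
        · exact Or.inl rfl
        · exact Or.inr (Or.inr ⟨q, h, rfl⟩)

lemma exists_take_mem_leafPaths {t : BinaryTree Unit} {p : List (Fin 2)}
    (hp : t.height ≤ p.length) : ∃ k ≤ t.height, p.take k ∈ t.leafPaths := by
  induction t generalizing p with
  | nil => exact ⟨0, le_rfl, by simp [leafPaths]⟩
  | node v l r hl hr =>
    simp only [height] at hp ⊢
    rcases p with _ | ⟨a, p⟩
    · simp at hp
    · rw [List.length_cons] at hp
      revert hp
      fin_cases a <;> intro hp
      · obtain ⟨k, hk, h⟩ := hl (p := p) (by omega)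
        exact ⟨k + 1, by omega, cons_zero_mem_leafPaths.mpr h⟩
      · obtain ⟨k, hk, h⟩ := hr (p := p) (by omega)
        exact ⟨k + 1, by omega, cons_one_mem_leafPaths.mpr h⟩

lemma exists_leafPaths_subset {n : ℕ} {D : Set (List (Fin 2))}
    (hD : ∀ p : List (Fin 2), p.length = n → ∃ k ≤ n, p.take k ∈ D) :
    ∃ t : BinaryTree Unit, t.height ≤ n ∧ ∀ p ∈ t.leafPaths, p ∈ D := by
  by_cases h0 : [] ∈ D
  · exact ⟨nil, by simp [height], by simpa [leafPaths] using h0⟩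
  induction n generalizing D with
  | zero =>
    obtain ⟨k, -, hk⟩ := hD [] rfl
    exact absurd (by simpa using hk) h0
  | succ n ih =>
    have key : ∀ a : Fin 2, ∃ t : BinaryTree Unit, t.height ≤ n ∧
        ∀ p ∈ t.leafPaths, a :: p ∈ D := fun a => by
      by_cases ha : [a] ∈ D
      · exact ⟨nil, by simp [height], by simpa [leafPaths] using ha⟩
      refine ih (D := { p | a :: p ∈ D }) (fun p hp => ?_) ha
      obtain ⟨k, hk, h⟩ := hD (a :: p) (by simp [hp])
      rcases k with _ | k
      · exact absurd h h0
      · exact ⟨k, by omega, h⟩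
    obtain ⟨l, hl, hl'⟩ := key 0
    obtain ⟨r, hr, hr'⟩ := key 1
    refine ⟨node () l r, by simp only [height]; omega, fun p hp => ?_⟩
    simp only [leafPaths, Finset.mem_union, Finset.mem_image] at hp
    rcases hp with ⟨q, hq, rfl⟩ | ⟨q, hq, rfl⟩
    · exact hl' q hq
    · exact hr' q hq

end BinaryTree

section CutIdeal

variable {n : ℕ}

/-- The word of an edge of the binary tree, which describes its lower endpoint. -/
def edgeWord (e : TreeEdge 2 n) : List (Fin 2) := List.ofFn e.2

lemma edgeWord_injective : Function.Injective (edgeWord (n := n)) := by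
  rintro ⟨⟨i, hi⟩, f⟩ ⟨⟨j, hj⟩, g⟩ h
  have hij : i = j := by simpa [edgeWord] using congrArg List.length h
  subst hij
  obtain rfl : f = g := List.ofFn_injective h
  rfl

lemma exists_edgeWord_eq {p : List (Fin 2)} (hp : p ≠ []) (hn : p.length ≤ n) :
    ∃ e : TreeEdge 2 n, edgeWord e = p := by
  rcases p with _ | ⟨a, q⟩
  · exact absurd rfl hp
  · exact ⟨⟨⟨q.length, hn⟩, (a :: q).get⟩, List.ofFn_get (a :: q)⟩

lemma edgeWord_ne_nil (e : TreeEdge 2 n) : edgeWord e ≠ [] := by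
  simp [edgeWord]

lemma edgeWord_pathEdge (ℓ : TreeLeaf 2 n) (i : Fin n) :
    edgeWord (pathEdge ℓ i) = (List.ofFn ℓ).take (i + 1) := by
  refine List.ext_getElem ?_ fun k h1 h2 => ?_
  · have := i.2
    simp only [edgeWord, pathEdge, List.length_ofFn, List.length_take]
    omega
  · simp [edgeWord, pathEdge, -List.ofFn_succ]

/-- The edges whose lower endpoint lies in a set of words. -/
def wordEdges (n : ℕ) (s : Finset (List (Fin 2))) : Finset (TreeEdge 2 n) :=
  Finset.univ.filter fun e => edgeWord e ∈ s

lemma mem_wordEdges {s : Finset (List (Fin 2))} {e : TreeEdge 2 n} :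
    e ∈ wordEdges n s ↔ edgeWord e ∈ s := by
  simp [wordEdges]

lemma card_wordEdges {s : Finset (List (Fin 2))} (hs : ∀ p ∈ s, p.length ≤ n) :
    (wordEdges n s).card = (s.erase []).card := by
  rw [← Finset.card_image_of_injective _ edgeWord_injective]
  congr 1
  ext p
  simp only [Finset.mem_image, mem_wordEdges, Finset.mem_erase]
  constructor
  · rintro ⟨e, he, rfl⟩
    exact ⟨edgeWord_ne_nil e, he⟩
  · rintro ⟨h1, h2⟩
    obtain ⟨e, rfl⟩ := exists_edgeWord_eq h1 (hs p h2)
    exact ⟨e, h2, rfl⟩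

lemma card_wordEdges_leafPaths {t : BinaryTree Unit} (h0 : t ≠ .nil) (hn : t.height ≤ n) :
    (wordEdges n t.leafPaths).card = t.numNodes + 1 := by
  rw [card_wordEdges fun p hp => (BinaryTree.length_le_of_mem_leafPaths hp).trans hn,
    Finset.erase_eq_of_notMem (fun h => h0 (BinaryTree.nil_mem_leafPaths_iff.mp h)),
    BinaryTree.card_leafPaths]

lemma card_wordEdges_innerPaths {t : BinaryTree Unit} (h0 : t ≠ .nil) (hn : t.height ≤ n) :
    (wordEdges n t.innerPaths).card = t.numNodes - 1 := by
  rw [card_wordEdges fun p hp => (BinaryTree.length_le_of_mem_innerPaths hp).trans hn,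
    Finset.card_erase_of_mem (BinaryTree.nil_mem_innerPaths_iff.mpr h0),
    BinaryTree.card_innerPaths]

lemma treeIsCut_wordEdges_leafPaths {t : BinaryTree Unit} (h0 : t ≠ .nil) (hn : t.height ≤ n) :
    TreeIsCut (wordEdges n t.leafPaths) := by
  intro ℓ
  obtain ⟨k, hk, h⟩ := BinaryTree.exists_take_mem_leafPaths (t := t) (p := List.ofFn ℓ) (by simpa)
  rcases k with _ | k
  · exact absurd (BinaryTree.nil_mem_leafPaths_iff.mp h) h0
  · exact ⟨⟨k, by omega⟩, mem_wordEdges.mpr (by rwa [edgeWord_pathEdge])⟩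

lemma TreeIsCut.exists_tree {C : Finset (TreeEdge 2 n)} (hC : TreeIsCut C) :
    ∃ t : BinaryTree Unit, t ≠ .nil ∧ t.height ≤ n ∧ wordEdges n t.leafPaths ⊆ C := by
  obtain ⟨t, ht, h⟩ := BinaryTree.exists_leafPaths_subset (n := n)
    (D := { p | ∃ e ∈ C, edgeWord e = p }) fun p hp => by
      subst hp
      obtain ⟨i, hi⟩ := hC p.get
      exact ⟨i + 1, i.2, _, hi, by rw [edgeWord_pathEdge, List.ofFn_get]⟩
  refine ⟨t, ?_, ht, fun e he => ?_⟩
  · rintro rfl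
    obtain ⟨e, -, he⟩ := h [] (BinaryTree.nil_mem_leafPaths_iff.mpr rfl)
    exact edgeWord_ne_nil e he
  · obtain ⟨e', he', h'⟩ := h _ (mem_wordEdges.mp he)
    rwa [← edgeWord_injective h']

lemma TreeIsCut.exists_minCut {C : Finset (TreeEdge 2 n)} (hC : TreeIsCut C) :
    ∃ C' ⊆ C, TreeMinCut C' := by
  obtain ⟨C', hle, hmin⟩ := exists_minimal_le_of_wellFoundedLT TreeIsCut C hC
  exact ⟨C', hle, hmin.prop, fun C'' hsub h => hmin.eq_of_le h hsub⟩

/-- The nonempty trees of height at most `n`. -/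
def cutTrees (n : ℕ) : Finset (BinaryTree Unit) := (BinaryTree.treesOfHeightLE n).erase .nil

lemma mem_cutTrees {t : BinaryTree Unit} : t ∈ cutTrees n ↔ t ≠ .nil ∧ t.height ≤ n := by
  rw [cutTrees, Finset.mem_erase, BinaryTree.mem_treesOfHeightLE]

lemma cutIdeal_eq_sqIdeal (K : Type) [Field K] (n : ℕ) :
    cutIdeal K 2 n = sqIdeal K (fun t : BinaryTree Unit => wordEdges n t.leafPaths)
      (cutTrees n : Set (BinaryTree Unit)) := by
  have hdvd : ∀ {C C' : Finset (TreeEdge 2 n)} {I : Ideal (MvPolynomial (TreeEdge 2 n) K)},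
      C' ⊆ C → (∏ e ∈ C', X e) ∈ I → (∏ e ∈ C, X e) ∈ I := fun h hI =>
    Ideal.mem_of_dvd _ (Finset.prod_dvd_prod_of_subset _ _ _ h) hI
  refine le_antisymm (Ideal.span_le.mpr ?_) (Ideal.span_le.mpr ?_)
  · rintro _ ⟨C, hC, rfl⟩
    obtain ⟨t, h0, hn, hsub⟩ := hC.1.exists_tree
    exact hdvd hsub (Ideal.subset_span ⟨t, mem_cutTrees.mpr ⟨h0, hn⟩, rfl⟩)
  · rintro _ ⟨t, ht, rfl⟩
    obtain ⟨h0, hn⟩ := mem_cutTrees.mp ht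
    obtain ⟨C, hsub, hC⟩ := (treeIsCut_wordEdges_leafPaths h0 hn).exists_minCut
    exact hdvd hsub (Ideal.subset_span ⟨C, hC, rfl⟩)

lemma card_filter_cutTrees {m : ℕ} (hm : 1 ≤ m) (hn : m ≤ n) :
    ((cutTrees n).filter fun t => t.numNodes = m).card = catalan m := by
  rw [← BinaryTree.treesOfNumNodesEq_card_eq_catalan]
  congr 1
  ext t
  rw [Finset.mem_filter, mem_cutTrees, BinaryTree.mem_treesOfNumNodesEq]
  refine ⟨fun h => h.2, fun h => ⟨⟨?_, ?_⟩, h⟩⟩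
  · rintro rfl
    simp only [BinaryTree.numNodes] at h
    omega
  · exact t.height_le_numNodes.trans (by omega)

/-- The graded Betti numbers of the cut ideal of the binary tree of depth `n`. -/
theorem MinGradedFreeRes.betti_cutIdeal {K : Type} [Field K] {b : ℕ → ℕ → ℕ}
    (R : MinGradedFreeRes K (TreeEdge 2 n) (cutIdeal K 2 n) b) (i j : ℕ) :
    b (i + 1) j = ∑ t ∈ cutTrees n,
      if j = i + (t.numNodes + 1) then (t.numNodes - 1).choose i else 0 := by
  rw [cutIdeal_eq_sqIdeal] at R
  have hcard : ∀ t ∈ cutTrees n, (wordEdges n t.leafPaths).card = t.numNodes + 1 := fun t ht =>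
    card_wordEdges_leafPaths (mem_cutTrees.mp ht).1 (mem_cutTrees.mp ht).2
  obtain ⟨p, hp, hpb⟩ := hasBetti_linear_quotients (K := K)
    (fun t : BinaryTree Unit => wordEdges n t.leafPaths)
    (fun t => wordEdges n t.innerPaths) (cutTrees n)
    (fun t ht => by rw [hcard t ht]; omega)
    (fun t _ => by
      rw [Finset.disjoint_left]
      intro e h1 h2
      exact Finset.disjoint_left.mp (BinaryTree.disjoint_innerPaths_leafPaths t)
        (mem_wordEdges.mp h1) (mem_wordEdges.mp h2))
    (fun t ht t' ht' hne hle => by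
      rw [hcard t ht, hcard t' ht'] at hle
      obtain ⟨q, hq, hq'⟩ := BinaryTree.exists_mem_leafPaths_mem_innerPaths hne (by omega)
      obtain ⟨h0', hn'⟩ := mem_cutTrees.mp ht'
      obtain ⟨e, rfl⟩ := exists_edgeWord_eq (n := n) (p := q)
        (by rintro rfl; exact h0' (BinaryTree.nil_mem_leafPaths_iff.mp hq))
        ((BinaryTree.length_le_of_mem_leafPaths hq).trans hn')
      exact ⟨e, mem_wordEdges.mpr hq, mem_wordEdges.mpr hq'⟩)
    (fun t ht e he => by
      obtain ⟨t', h1, h2, h3, h4⟩ := BinaryTree.exists_prune (mem_wordEdges.mp he)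
      have ht' := mem_cutTrees.mpr ⟨h3 (edgeWord_ne_nil e), h2.trans (mem_cutTrees.mp ht).2⟩
      refine ⟨t', ht', by rw [hcard t ht, hcard t' ht']; omega, fun x hx => ?_⟩
      exact (h4 _ (mem_wordEdges.mp hx)).imp (fun h => edgeWord_injective h) mem_wordEdges.mpr)
  rw [R.betti_eq hp, hpb]
  refine Finset.sum_congr rfl fun t ht => ?_
  rw [hcard t ht, card_wordEdges_innerPaths (mem_cutTrees.mp ht).1 (mem_cutTrees.mp ht).2]

theorem MinGradedFreeRes.betti_cutIdeal_add {K : Type} [Field K] {b : ℕ → ℕ → ℕ}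
    (R : MinGradedFreeRes K (TreeEdge 2 n) (cutIdeal K 2 n) b) {i m : ℕ} (hi : 1 ≤ i)
    (hm : 1 ≤ m) (hn : m ≤ n) : b i (i + m) = catalan m * (m - 1).choose (i - 1) := by
  obtain ⟨i, rfl⟩ := Nat.exists_eq_add_of_le' hi
  rw [R.betti_cutIdeal, ← card_filter_cutTrees hm hn, ← smul_eq_mul, ← Finset.sum_const,
    Finset.sum_filter]
  refine Finset.sum_congr rfl fun t _ => ?_
  by_cases h : t.numNodes = m
  · subst h
    rw [if_pos (by omega), if_pos rfl, Nat.add_sub_cancel]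
  · rw [if_neg (by omega), if_neg h]

theorem MinGradedFreeRes.betti_cutIdeal_eq_zero {K : Type} [Field K] {b : ℕ → ℕ → ℕ}
    (R : MinGradedFreeRes K (TreeEdge 2 n) (cutIdeal K 2 n) b) {i j : ℕ} (hi : 1 ≤ i)
    (hj : j ≤ i) : b i j = 0 := by
  obtain ⟨i, rfl⟩ := Nat.exists_eq_add_of_le' hi
  rw [R.betti_cutIdeal]
  refine Finset.sum_eq_zero fun t ht => if_neg fun h => (mem_cutTrees.mp ht).1 ?_
  cases t with
  | nil => rfl
  | node v l r =>
    simp only [BinaryTree.numNodes] at h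
    omega

end CutIdeal

lemma catalan_mul_choose_eq_factorial_div {i m : ℕ} (hi : 1 ≤ i) (him : i ≤ m) :
    catalan m * (m - 1).choose (i - 1) = (2 * m).factorial /
      ((m + 1) * m * m.factorial * (m - i).factorial * (i - 1).factorial) := by
  have hpos : 0 < m := by omega
  refine (Nat.div_eq_of_eq_mul_left (by positivity) ?_).symm
  have h1 := succ_mul_catalan_eq_centralBinom m
  have h2 := Nat.choose_mul_factorial_mul_factorial (show m ≤ 2 * m by omega)
  have h3 := Nat.choose_mul_factorial_mul_factorial (show i - 1 ≤ m - 1 by omega)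
  have h4 := Nat.mul_factorial_pred (show m ≠ 0 by omega)
  rw [show 2 * m - m = m by omega, ← Nat.centralBinom_eq_two_mul_choose, ← h1] at h2
  rw [show m - 1 - (i - 1) = m - i by omega] at h3
  calc (2 * m).factorial = (m + 1) * catalan m * m.factorial * (m * (m - 1).factorial) := by
        rw [h4, h2]
    _ = _ := by
        rw [← h3]
        ring

/-- The asymptotic graded Betti numbers of the cut ideal of the infinite binary
tree: for each `i ≥ 1` and `j`, the graded Betti number `β_{i,j}` of (the quotient
by) the cut ideal `J_{2,n}` is eventually constant in `n`, with eventual value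
`(2(j-i))! / ((j-i+1)(j-i)(j-i)!(j-2i)!(i-1)!)` for `j ≥ 2i` and `0` otherwise;
equivalently, for `j ≥ 1`, `β_{i,i+j} = c_j ⬝ binomial (j-1) (i-1)` eventually,
where `c_j` is the `j`-th Catalan number. -/
theorem cutIdeal_asymptotic_betti (K : Type) [Field K] :
    ∀ i j : ℕ, 1 ≤ i →
      (∃ N : ℕ, ∀ n ≥ N, ∀ b : ℕ → ℕ → ℕ,
        MinGradedFreeRes K (TreeEdge 2 n) (cutIdeal K 2 n) b →
        b i j = if 2 * i ≤ j then
            (2 * (j - i)).factorial /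
              ((j - i + 1) * (j - i) * (j - i).factorial *
                (j - 2 * i).factorial * (i - 1).factorial)
          else 0) ∧
      (1 ≤ j → ∃ N : ℕ, ∀ n ≥ N, ∀ b : ℕ → ℕ → ℕ,
        MinGradedFreeRes K (TreeEdge 2 n) (cutIdeal K 2 n) b →
        b i (i + j) = catalan j * Nat.choose (j - 1) (i - 1)) := by
  intro i j hi
  refine ⟨⟨j, fun n hn b R => ?_⟩, fun hj => ⟨j, fun n hn b R => R.betti_cutIdeal_add hi hj hn⟩⟩
  by_cases hij : j ≤ i
  · rw [R.betti_cutIdeal_eq_zero hi hij, if_neg (by omega)]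
  obtain ⟨m, rfl⟩ := Nat.exists_eq_add_of_le (le_of_not_ge hij)
  rw [R.betti_cutIdeal_add hi (by omega) (by omega)]
  split_ifs with h
  · rw [catalan_mul_choose_eq_factorial_div hi (by omega), Nat.add_sub_cancel_left,
      show i + m - 2 * i = m - i by omega]
  · rw [Nat.choose_eq_zero_of_lt (by omega), mul_zero]
end
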